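/- arXiv:2601.02912 — 11 statements merged into one kernel-verified Lean document; each statement's English description precedes it below -/
import Mathlib

section
/- Let M be an m×n integer matrix of rank r over ℚ, and suppose P ∈ GL_m(ℤ) and Q ∈ GL_n(ℤ) and positive integers d_1 ∣ d_2 ∣ ⋯ ∣ d_r are such that PMQ is the m×n diagonal matrix with diagonal entries d_1,…,d_r followed by zeros. Let c ∈ ℤ^m and let q be a positive integer. If there exists x ∈ (ℤ/qℤ)^n with [M]_q x = [c]_q, then the number of solutions x ∈ (ℤ/qℤ)^n of [M]_q x = [c]_q equals q^{n−r} · ∏_{j=1}^{r} gcd(q, d_j). -/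
open Matrix

/-- The number of solutions of `a * t = 0` in `ZMod q` is `gcd(q, a)`. -/
theorem ZMod.card_intCast_mul_eq_zero (q : ℕ) [NeZero q] (a : ℤ) :
    Nat.card {t : ZMod q // (a : ZMod q) * t = 0} = Int.gcd q a := by
  have h := IsAddCyclic.card_nsmulAddMonoidHom_ker (G := ZMod q) a.natAbs
  rw [Nat.card_zmod] at h
  rw [Int.gcd_def, Int.natAbs_natCast, ← h]
  refine Nat.card_congr (Equiv.subtypeEquivRight fun t => ?_)
  rw [AddMonoidHom.mem_ker, nsmulAddMonoidHom_apply, nsmul_eq_mul]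
  rcases Int.natAbs_eq a with h | h
  · rw [← Int.cast_natCast (R := ZMod q), ← h]
  · have h' : ((a.natAbs : ℕ) : ZMod q) = -(a : ZMod q) := by
      rw [← Int.cast_natCast (R := ZMod q), ← Int.cast_neg]
      congr 1
      omega
    rw [h', neg_mul, neg_eq_zero]

/-- A solvable linear system has as many solutions as the homogeneous system attached to an
equivalent matrix. -/
theorem Matrix.card_mulVec_eq_of_equivalent {m n R : Type*} [Fintype m] [DecidableEq m]
    [Fintype n] [DecidableEq n] [CommRing R] (A : Matrix m n R) {P : Matrix m m R}
    {Q : Matrix n n R} (hP : IsUnit P) (hQ : IsUnit Q) {c : m → R} {x₀ : n → R}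
    (hx₀ : A *ᵥ x₀ = c) :
    Nat.card {x : n → R // A *ᵥ x = c} = Nat.card {y : n → R // (P * A * Q) *ᵥ y = 0} := by
  have hQb : Function.Bijective Q.mulVec :=
    ⟨Matrix.mulVec_injective_of_isUnit hQ, Matrix.mulVec_surjective_iff_isUnit.2 hQ⟩
  refine (Nat.card_congr (((Equiv.ofBijective _ hQb).trans (Equiv.addRight x₀)).subtypeEquiv
    fun y => ?_)).symm
  simp only [Equiv.trans_apply, Equiv.ofBijective_apply, Equiv.coe_addRight]
  rw [Matrix.mulVec_add, hx₀, add_eq_right, Matrix.mul_assoc, ← Matrix.mulVec_mulVec,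
    ← Matrix.mulVec_mulVec]
  exact (Matrix.mulVec_injective_of_isUnit hP).eq_iff' (Matrix.mulVec_zero P)

/-- The kernel of a rectangular diagonal matrix is described coordinatewise. -/
theorem Matrix.rectDiagonal_mulVec_eq_zero_iff {R : Type*} [CommRing R] {m n r : ℕ} (hm : r ≤ m)
    (d : ℕ → R) (y : Fin n → R) :
    (Matrix.of fun (i : Fin m) (j : Fin n) =>
        if (i : ℕ) = (j : ℕ) ∧ (i : ℕ) < r then d i else 0) *ᵥ y = 0 ↔
      ∀ j : Fin n, (if (j : ℕ) < r then d j else 0) * y j = 0 := by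
  have key (i : Fin m) (j : Fin n) (hij : (i : ℕ) = j) :
      ((Matrix.of fun (i : Fin m) (j : Fin n) =>
        if (i : ℕ) = (j : ℕ) ∧ (i : ℕ) < r then d i else 0) *ᵥ y) i =
      (if (j : ℕ) < r then d j else 0) * y j := by
    rw [Matrix.mulVec, dotProduct, Finset.sum_eq_single j]
    · simp [hij]
    · intro k _ hk
      have : (i : ℕ) ≠ k := fun h => hk (Fin.ext (h.symm.trans hij))
      simp [this]
    · simp
  constructor
  · intro h j
    by_cases hj : (j : ℕ) < r
    · rw [← key ⟨j, hj.trans_le hm⟩ j rfl, h, Pi.zero_apply]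
    · simp [hj]
  · intro h
    ext i
    by_cases hi : (i : ℕ) < n
    · rw [key i ⟨i, hi⟩ rfl, h, Pi.zero_apply]
    · rw [Matrix.mulVec, dotProduct, Pi.zero_apply]
      refine Finset.sum_eq_zero fun k _ => ?_
      have : (i : ℕ) ≠ k := by omega
      simp [this]

/-- Let `M` be an `m×n` integer matrix of rank `r` over `ℚ`, with a Smith
normal form witnessed by unimodular `P`, `Q` and positive integers `d 0 ∣ d 1 ∣ ⋯ ∣ d (r-1)`.
If the system `[M]_q x = [c]_q` has a solution in `(ℤ/qℤ)^n`, then its number of solutions is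
`q^(n-r) * ∏_{j<r} gcd(q, d j)`. -/
theorem statement0 {m n r : ℕ} (M : Matrix (Fin m) (Fin n) ℤ)
    (hrank : (M.map (Int.cast : ℤ → ℚ)).rank = r)
    (P : Matrix (Fin m) (Fin m) ℤ) (Q : Matrix (Fin n) (Fin n) ℤ)
    (hP : IsUnit P.det) (hQ : IsUnit Q.det)
    (d : ℕ → ℤ) (hdpos : ∀ j, j < r → 0 < d j)
    (hdvd : ∀ j, j + 1 < r → d j ∣ d (j + 1))
    (hdiag : P * M * Q = Matrix.of (fun (i : Fin m) (j : Fin n) =>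
      if (i : ℕ) = (j : ℕ) ∧ (i : ℕ) < r then d (i : ℕ) else 0))
    (c : Fin m → ℤ) (q : ℕ) (hq : 0 < q)
    (hsol : ∃ x : Fin n → ZMod q,
      ∀ i, (M.map (Int.cast : ℤ → ZMod q)).mulVec x i = (c i : ZMod q)) :
    Nat.card {x : Fin n → ZMod q //
        ∀ i, (M.map (Int.cast : ℤ → ZMod q)).mulVec x i = (c i : ZMod q)} =
      q ^ (n - r) * ∏ j ∈ Finset.range r, Int.gcd (q : ℤ) (d j) := by
  have : NeZero q := ⟨hq.ne'⟩
  have hm : r ≤ m := hrank ▸ Matrix.rank_le_height _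
  have hn : r ≤ n := hrank ▸ Matrix.rank_le_width _
  obtain ⟨x₀, hx₀⟩ := hsol
  have hunit {k : ℕ} {U : Matrix (Fin k) (Fin k) ℤ} (hU : IsUnit U.det) :
      IsUnit (U.map (Int.cast : ℤ → ZMod q)) :=
    ((Matrix.isUnit_iff_isUnit_det U).2 hU).map (Int.castRingHom (ZMod q)).mapMatrix
  have hD : P.map (Int.cast : ℤ → ZMod q) * M.map (Int.cast : ℤ → ZMod q) *
      Q.map (Int.cast : ℤ → ZMod q) = Matrix.of (fun (i : Fin m) (j : Fin n) =>
      if (i : ℕ) = (j : ℕ) ∧ (i : ℕ) < r then (d (i : ℕ) : ZMod q) else 0) := by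
    have h := congrArg (fun A => A.map (Int.castRingHom (ZMod q))) hdiag
    simp only [Matrix.map_mul] at h
    refine h.trans ?_
    ext i j
    simp [apply_ite (Int.cast : ℤ → ZMod q)]
  have hcard := Matrix.card_mulVec_eq_of_equivalent (M.map (Int.cast : ℤ → ZMod q))
    (hunit hP) (hunit hQ) (funext hx₀)
  simp only [← funext_iff]
  rw [hcard, hD]
  simp only [Matrix.rectDiagonal_mulVec_eq_zero_iff hm (fun j => (d j : ZMod q))]
  have hfactor (j : Fin n) : Nat.card {t : ZMod q //
      (if (j : ℕ) < r then (d j : ZMod q) else 0) * t = 0} =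
      if (j : ℕ) < r then Int.gcd q (d j) else q := by
    split_ifs
    · exact ZMod.card_intCast_mul_eq_zero q (d j)
    · simp
  rw [Nat.card_congr (Equiv.subtypePiEquivPi (p := fun (j : Fin n) (t : ZMod q) =>
    (if (j : ℕ) < r then (d j : ZMod q) else 0) * t = 0)), Nat.card_pi]
  simp only [hfactor]
  rw [← Finset.prod_range (fun j => if j < r then Int.gcd q (d j) else q),
    ← Finset.prod_range_mul_prod_Ico _ hn, mul_comm]
  congr 1
  · rw [Finset.prod_congr rfl fun j hj => if_neg (Finset.mem_Ico.1 hj).1.not_gt]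
    simp
  · exact Finset.prod_congr rfl fun j hj => if_pos (Finset.mem_range.1 hj)
end

section
/- There exist a nonnegative integer q₀ and a positive integer ρ such that for every integer q > q₀ with gcd(q,ρ) = 1, N_{A,𝒂,B,𝒃}(q) = Σ_J (−1)^{|J|} q^{n − rank C_J}, the sum being over all J ⊆ {1,…,m} with rank [C_J | c_J] = rank C_J. In other words, for such q the counting function equals the characteristic polynomial of the truncated arrangement evaluated at q. -/
open Matrix

/-- The rank over `ℚ` of an integer matrix. -/
noncomputable def rkQ {ι κ : Type*} [Fintype ι] [Fintype κ] (M : Matrix ι κ ℤ) : ℕ :=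
  (M.map (Int.cast : ℤ → ℚ)).rank

/-- The matrix `C_J`: `B` stacked on top of the rows of `A` indexed by `J`. -/
def stackJ {m n l : ℕ} (B : Matrix (Fin l) (Fin n) ℤ) (A : Matrix (Fin m) (Fin n) ℤ)
    (J : Finset (Fin m)) : Matrix (Fin l ⊕ {i // i ∈ J}) (Fin n) ℤ :=
  Matrix.fromRows B (A.submatrix (fun i : {i // i ∈ J} => i.1) id)

/-- The vector `c_J`: `b` stacked on top of the entries of `a` indexed by `J`. -/
def cvecJ {m l : ℕ} (b : Fin l → ℤ) (a : Fin m → ℤ) (J : Finset (Fin m)) :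
    Fin l ⊕ {i // i ∈ J} → ℤ :=
  Sum.elim b (fun i => a i.1)

/-- The augmented matrix `[C | c]`. -/
def augM {n : ℕ} {ι : Type*} (C : Matrix ι (Fin n) ℤ) (c : ι → ℤ) :
    Matrix ι (Fin n ⊕ Unit) ℤ :=
  Matrix.of fun i => Sum.elim (C i) (fun _ => c i)

/-- Over a field, the kernel of a matrix is split by a pair of matrices `U`, `V`, with the
complementary idempotent factoring through the matrix. -/
theorem exists_kernel_splitting {K ι κ : Type*} [Field K] [Fintype ι] [Fintype κ]
    [DecidableEq ι] [DecidableEq κ] (C : Matrix ι κ K) :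
    ∃ (U : Matrix κ (Fin (Fintype.card κ - C.rank)) K)
      (V : Matrix (Fin (Fintype.card κ - C.rank)) κ K) (G : Matrix κ ι K),
      C * U = 0 ∧ V * U = 1 ∧ U * V + G * C = 1 := by
  set f : (κ → K) →ₗ[K] (ι → K) := Matrix.toLin' C with hf
  obtain ⟨s, hs⟩ := f.rangeRestrict.exists_rightInverse_of_surjective f.range_rangeRestrict
  obtain ⟨g, hg⟩ := LinearMap.exists_extend s
  have hgf (x : κ → K) : f (g (f x)) = f x := by
    have h1 : g (f x) = s (f.rangeRestrict x) := by
      rw [← hg]; rfl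
    have h2 := congrArg Subtype.val (LinearMap.congr_fun hs (f.rangeRestrict x))
    rw [h1]
    simpa using h2
  let p : (κ → K) →ₗ[K] LinearMap.ker f :=
    (LinearMap.id - g ∘ₗ f).codRestrict _ fun x => by simp [hgf]
  have hdim : Module.finrank K (LinearMap.ker f) = Fintype.card κ - C.rank := by
    have h := f.finrank_range_add_finrank_ker
    have hr : Module.finrank K (LinearMap.range f) = C.rank := rfl
    rw [hr, Module.finrank_fintype_fun_eq_card] at h
    omega
  let e : LinearMap.ker f ≃ₗ[K] (Fin (Fintype.card κ - C.rank) → K) :=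
    (Module.finBasisOfFinrankEq K _ hdim).equivFun
  have hC : C = LinearMap.toMatrix' f := by simp [hf]
  refine ⟨LinearMap.toMatrix' ((LinearMap.ker f).subtype ∘ₗ e.symm.toLinearMap),
    LinearMap.toMatrix' (e.toLinearMap ∘ₗ p), LinearMap.toMatrix' g, ?_, ?_, ?_⟩
  · refine (congrArg (· * _) hC).trans ?_
    rw [← LinearMap.toMatrix'_comp, ← map_zero LinearMap.toMatrix']
    congr 1
    ext1 i
    ext1
    simp
  · rw [← LinearMap.toMatrix'_comp, ← LinearMap.toMatrix'_id]
    congr 1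
    refine LinearMap.ext fun y => ?_
    have hp : p (e.symm y) = e.symm y := by
      ext1
      have h0 : f (e.symm y) = 0 := (e.symm y).2
      simp [p, h0]
    simp [hp]
  · refine (congrArg (fun M => _ + _ * M) hC).trans ?_
    rw [← LinearMap.toMatrix'_comp, ← LinearMap.toMatrix'_comp, ← map_add,
      ← LinearMap.toMatrix'_id]
    congr 1
    refine LinearMap.ext fun x => ?_
    simp [p]

/-- Casting an integer matrix into a ring commutes with integer scaling. -/
theorem map_castRingHom_smul {R ι κ : Type*} [Ring R] (z : ℤ) (M : Matrix ι κ ℤ) :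
    (z • M).map (Int.castRingHom R) = (z : R) • M.map (Int.castRingHom R) := by
  ext; simp

/-- Clearing denominators in a rational matrix. -/
theorem exists_int_matrix_smul {ι κ : Type*} [Fintype ι] [Fintype κ] (M : Matrix ι κ ℚ) :
    ∃ (d : ℤ) (N : Matrix ι κ ℤ), d ≠ 0 ∧ N.map (Int.cast : ℤ → ℚ) = (d : ℚ) • M := by
  refine ⟨M.den, M.num, by exact_mod_cast M.den_ne_zero, ?_⟩
  have h : (M.den : ℚ) ≠ 0 := by exact_mod_cast M.den_ne_zero
  refine Eq.trans ?_ (congrArg _ (Matrix.inv_denom_smul_num M))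
  rw [smul_smul, Int.cast_natCast, mul_inv_cancel₀ h, one_smul]

/-- An integral version of `exists_kernel_splitting`, up to a nonzero factor. -/
theorem exists_int_kernel_splitting {ι κ : Type*} [Fintype ι] [Fintype κ]
    [DecidableEq ι] [DecidableEq κ] (C : Matrix ι κ ℤ) :
    ∃ (d : ℤ) (U : Matrix κ (Fin (Fintype.card κ - rkQ C)) ℤ)
      (V : Matrix (Fin (Fintype.card κ - rkQ C)) κ ℤ) (G : Matrix κ ι ℤ),
      d ≠ 0 ∧ C * U = 0 ∧ V * U = d • (1 : Matrix _ _ ℤ) ∧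
        U * V + G * C = d • (1 : Matrix _ _ ℤ) := by
  have hcast : C.map (Int.cast : ℤ → ℚ) = C.map (Int.castRingHom ℚ) := rfl
  rw [rkQ, hcast]
  obtain ⟨U, V, G, h1, h2, h3⟩ := exists_kernel_splitting (C.map (Int.castRingHom ℚ))
  obtain ⟨u, U', hu, hU⟩ := exists_int_matrix_smul U
  obtain ⟨v, V', hv, hV⟩ := exists_int_matrix_smul V
  obtain ⟨w, G', hw, hG⟩ := exists_int_matrix_smul G
  have hinj : Function.Injective (Int.castRingHom ℚ) := Int.cast_injective
  have hU' : U'.map (Int.castRingHom ℚ) = (u : ℚ) • U := hU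
  have hV' : V'.map (Int.castRingHom ℚ) = (v : ℚ) • V := hV
  have hG' : G'.map (Int.castRingHom ℚ) = (w : ℚ) • G := hG
  refine ⟨u * v * w, w • U', V', (u * v) • G', by positivity,
    Matrix.map_injective hinj ?_, Matrix.map_injective hinj ?_, Matrix.map_injective hinj ?_⟩ <;>
    beta_reduce
  · rw [Matrix.map_mul, map_castRingHom_smul, hU']
    rw [Matrix.mul_smul, Matrix.mul_smul, h1, smul_zero, smul_zero,
      Matrix.map_zero _ (map_zero _)]
  · rw [Matrix.map_mul, map_castRingHom_smul, map_castRingHom_smul, hU', hV',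
      Matrix.map_one _ (map_zero _) (map_one _)]
    simp only [Matrix.mul_smul, Matrix.smul_mul, h2, smul_smul]
    push_cast; congr 1; ring
  · rw [Matrix.map_add _ (map_add _),
      Matrix.map_mul, Matrix.map_mul, map_castRingHom_smul, map_castRingHom_smul,
      map_castRingHom_smul, hU', hV', hG',
      Matrix.map_one _ (map_zero _) (map_one _), ← h3]
    simp only [Matrix.mul_smul, Matrix.smul_mul, smul_smul, smul_add]
    push_cast
    congr 2
    ring

/-- Modulo `q` prime to a suitable integer, the kernel of an integer matrix is free of the
expected rank. -/
theorem exists_card_ker_zmod {ι κ : Type*} [Fintype ι] [Fintype κ]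
    (C : Matrix ι κ ℤ) :
    ∃ d : ℤ, d ≠ 0 ∧ ∀ q : ℕ, 0 < q → IsUnit (d : ZMod q) →
      Nat.card {x : κ → ZMod q // (C.map (Int.cast : ℤ → ZMod q)).mulVec x = 0} =
        q ^ (Fintype.card κ - rkQ C) := by
  classical
  obtain ⟨d, U, V, G, hd, h1, h2, h3⟩ := exists_int_kernel_splitting C
  refine ⟨d, hd, fun q hq hu => ?_⟩
  have : NeZero q := ⟨hq.ne'⟩
  let φ := Int.castRingHom (ZMod q)
  have k1 : C.map φ * U.map φ = 0 := by rw [← Matrix.map_mul, h1]; ext; simp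
  have k2 : V.map φ * U.map φ = (d : ZMod q) • 1 := by
    rw [← Matrix.map_mul, h2, map_castRingHom_smul,
      Matrix.map_one _ (map_zero _) (map_one _)]
  have k3 : U.map φ * V.map φ + G.map φ * C.map φ = (d : ZMod q) • 1 := by
    rw [← Matrix.map_mul, ← Matrix.map_mul, ← Matrix.map_add _ (map_add φ), h3,
      map_castRingHom_smul, Matrix.map_one _ (map_zero _) (map_one _)]
  obtain ⟨e, he⟩ := hu.exists_left_inv
  let E : {x : κ → ZMod q // (C.map φ).mulVec x = 0} ≃
      (Fin (Fintype.card κ - rkQ C) → ZMod q) :=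
    { toFun x := (V.map φ).mulVec x.1
      invFun y := ⟨e • (U.map φ).mulVec y, by
        rw [Matrix.mulVec_smul, Matrix.mulVec_mulVec, k1, Matrix.zero_mulVec, smul_zero]⟩
      left_inv x := by
        ext1
        have h := congrArg (fun M => M.mulVec x.1) k3
        simp only [Matrix.add_mulVec, ← Matrix.mulVec_mulVec, x.2, Matrix.mulVec_zero,
          add_zero, Matrix.smul_mulVec, Matrix.one_mulVec] at h
        simp only [h, smul_smul, he, one_smul]
      right_inv y := by
        simp only [Matrix.mulVec_smul, Matrix.mulVec_mulVec, k2, Matrix.smul_mulVec,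
          Matrix.one_mulVec, smul_smul, he, one_smul] }
  calc _ = Nat.card (Fin (Fintype.card κ - rkQ C) → ZMod q) := Nat.card_congr E
    _ = _ := by simp

/-- A linear system over a field is solvable iff the augmented matrix has the same rank. -/
theorem rank_fromCols_eq_iff {K ι κ : Type*} [Field K] [Fintype ι] [Fintype κ]
    (C : Matrix ι κ K) (c : ι → K) :
    (Matrix.fromCols C (Matrix.replicateCol Unit c)).rank = C.rank ↔
      ∃ x, C.mulVec x = c := by
  have hr : LinearMap.range (Matrix.fromCols C (Matrix.replicateCol Unit c)).mulVecLin =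
      LinearMap.range C.mulVecLin ⊔ Submodule.span K {c} := by
    rw [Matrix.range_mulVecLin, Matrix.range_mulVecLin, ← Submodule.span_union]
    congr 1
    ext v
    simp only [Set.mem_range, Sum.exists, Set.mem_union, Set.mem_singleton_iff]
    refine or_congr Iff.rfl ⟨fun ⟨_, h⟩ => h.symm, fun h => ⟨(), h.symm⟩⟩
  have hmem : (∃ x, C.mulVec x = c) ↔ c ∈ LinearMap.range C.mulVecLin := by simp
  rw [hmem, Matrix.rank, Matrix.rank, hr]
  constructor
  · intro h
    rw [Submodule.eq_of_le_of_finrank_eq le_sup_left h.symm]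
    exact Submodule.mem_sup_right (Submodule.mem_span_singleton_self c)
  · intro h
    rw [sup_eq_left.2 ((Submodule.span_singleton_le_iff_mem _ _).2 h)]

/-- An integer system without rational solutions is refuted by an integer combination of
its equations. -/
theorem exists_int_vecMul_eq_zero {ι κ : Type*} [Fintype ι] [Fintype κ]
    (C : Matrix ι κ ℤ) (c : ι → ℤ)
    (h : ¬ ∃ x : κ → ℚ, (C.map (Int.cast : ℤ → ℚ)).mulVec x = fun i => (c i : ℚ)) :
    ∃ y : ι → ℤ, Matrix.vecMul y C = 0 ∧ y ⬝ᵥ c ≠ 0 := by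
  classical
  have h' : (fun i => (c i : ℚ)) ∉
      LinearMap.range (C.map (Int.cast : ℤ → ℚ)).mulVecLin := by
    simpa using h
  obtain ⟨g, hg, hle⟩ := Submodule.exists_le_ker_of_notMem h'
  obtain ⟨d, N, hd, hN⟩ := exists_int_matrix_smul
    (LinearMap.toMatrix' (LinearMap.pi fun _ : Unit => g))
  have hNi (v : ι → ℚ) : ∑ i, (N () i : ℚ) * v i = d * g v := by
    have h1 := LinearMap.toMatrix'_mulVec (LinearMap.pi fun _ : Unit => g) v
    have h2 := congrFun (congrArg (fun M => M.mulVec v) hN) ()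
    rw [Matrix.smul_mulVec, h1] at h2
    simpa [Matrix.mulVec, dotProduct] using h2
  refine ⟨N (), ?_, fun h0 => ?_⟩
  · ext j
    have h1 := hNi ((C.map (Int.cast : ℤ → ℚ)).mulVec (Pi.single j 1))
    have h2 : g ((C.map (Int.cast : ℤ → ℚ)).mulVec (Pi.single j 1)) = 0 :=
      hle ⟨Pi.single j 1, rfl⟩
    rw [h2] at h1
    simp only [Matrix.mulVec_single_one, Matrix.col_apply, Matrix.map_apply, mul_zero] at h1
    simp only [Matrix.vecMul, dotProduct, Pi.zero_apply]
    exact_mod_cast h1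
  · have h1 := hNi (fun i => (c i : ℚ))
    have h2 : (∑ i, (N () i : ℚ) * c i) = 0 := by
      have h3 : (∑ i, N () i * c i) = 0 := h0
      exact_mod_cast h3
    rw [h2] at h1
    exact (mul_ne_zero (by exact_mod_cast hd) hg) h1.symm

/-- Modulo `q > 1` prime to a suitable integer, the number of solutions of an integer linear
system is determined by the rational ranks of the matrix and the augmented matrix. -/
theorem exists_card_solutions_zmod {n : ℕ} {ι : Type*} [Fintype ι]
    (C : Matrix ι (Fin n) ℤ) (c : ι → ℤ) :
    ∃ d : ℤ, d ≠ 0 ∧ ∀ q : ℕ, 1 < q → IsUnit (d : ZMod q) →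
      Nat.card {x : Fin n → ZMod q //
          ∀ k, (C.map (Int.cast : ℤ → ZMod q)).mulVec x k = (c k : ZMod q)} =
        if rkQ (augM C c) = rkQ C then q ^ (n - rkQ C) else 0 := by
  classical
  have haug : (augM C c).map (Int.cast : ℤ → ℚ) =
      Matrix.fromCols (C.map (Int.cast : ℤ → ℚ))
        (Matrix.replicateCol Unit fun i => (c i : ℚ)) := by
    ext i (j | j) <;> simp [augM]
  have hiff : rkQ (augM C c) = rkQ C ↔
      ∃ x, (C.map (Int.cast : ℤ → ℚ)).mulVec x = fun i => (c i : ℚ) := by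
    rw [rkQ, rkQ, haug, rank_fromCols_eq_iff]
  by_cases hsol : ∃ x, (C.map (Int.cast : ℤ → ℚ)).mulVec x = fun i => (c i : ℚ)
  · obtain ⟨d₁, hd₁, hker⟩ := exists_card_ker_zmod C
    obtain ⟨x, hx⟩ := hsol
    obtain ⟨d₂, N, hd₂, hN⟩ := exists_int_matrix_smul (Matrix.replicateCol Unit x)
    have hz (i : ι) : ∑ j, C i j * N j () = d₂ * c i := by
      have h1 := congrFun hx i
      have h2 (j) : (N j () : ℚ) = d₂ * x j := by
        simpa using congrFun (congrFun hN j) ()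
      have h3 : ∑ j, (C i j : ℚ) * N j () = d₂ * c i := by
        rw [← h1]
        simp only [h2, Matrix.mulVec, dotProduct, Finset.mul_sum, Matrix.map_apply]
        exact Finset.sum_congr rfl fun j _ => by ring
      exact_mod_cast h3
    refine ⟨d₁ * d₂, mul_ne_zero hd₁ hd₂, fun q hq hu => ?_⟩
    rw [Int.cast_mul, IsUnit.mul_iff] at hu
    rw [if_pos (hiff.2 ⟨x, hx⟩)]
    have hcard := hker q (by omega) hu.1
    rw [Fintype.card_fin] at hcard
    rw [← hcard]
    obtain ⟨e, he⟩ := hu.2.exists_left_inv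
    let z : Fin n → ZMod q := fun j => e * (N j () : ZMod q)
    have hzq : (C.map (Int.cast : ℤ → ZMod q)).mulVec z = fun i => (c i : ZMod q) := by
      ext i
      have h1 : ∑ j, (C i j : ZMod q) * (N j () : ZMod q) = d₂ * c i := by
        exact_mod_cast congrArg (Int.cast : ℤ → ZMod q) (hz i)
      calc _ = e * ∑ j, (C i j : ZMod q) * (N j () : ZMod q) := by
            simp only [Matrix.mulVec, dotProduct, Finset.mul_sum, Matrix.map_apply, z]
            exact Finset.sum_congr rfl fun j _ => by ring
        _ = _ := by rw [h1, ← mul_assoc, he, one_mul]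
    refine Nat.card_congr ((Equiv.subRight z).subtypeEquiv fun y => ?_)
    rw [Equiv.subRight_apply, Matrix.mulVec_sub, hzq, sub_eq_zero, funext_iff]
  · obtain ⟨y, hyC, hyc⟩ := exists_int_vecMul_eq_zero C c hsol
    refine ⟨y ⬝ᵥ c, hyc, fun q hq hu => ?_⟩
    rw [if_neg (mt hiff.1 hsol)]
    have : Fact (1 < q) := ⟨hq⟩
    rw [Nat.card_eq_zero]
    refine Or.inl ⟨fun ⟨x, hx⟩ => hu.ne_zero ?_⟩
    have h1 : (fun i => (y i : ZMod q)) ⬝ᵥ (C.map (Int.cast : ℤ → ZMod q)).mulVec x = 0 := by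
      rw [Matrix.dotProduct_mulVec]
      have : Matrix.vecMul (fun i => (y i : ZMod q)) (C.map (Int.cast : ℤ → ZMod q)) = 0 := by
        ext j
        have h := congrArg (Int.cast : ℤ → ZMod q) (congrFun hyC j)
        simp only [Matrix.vecMul, dotProduct, Pi.zero_apply] at h
        simp only [Matrix.vecMul, dotProduct, Pi.zero_apply, Matrix.map_apply]
        exact_mod_cast h
      rw [this, zero_dotProduct]
    rw [funext hx] at h1
    simp only [dotProduct] at h1 ⊢
    exact_mod_cast h1

/-- Inclusion–exclusion for the number of points of `s` violating all the conditions `p i`. -/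
theorem natCard_forall_not_eq_sum {X ι : Type*} [Finite X] [Fintype ι]
    (s : X → Prop) (p : ι → X → Prop) :
    (Nat.card {x // s x ∧ ∀ i, ¬ p i x} : ℤ) =
      ∑ J : Finset ι, (-1 : ℤ) ^ J.card * Nat.card {x // s x ∧ ∀ i ∈ J, p i x} := by
  classical
  have := Fintype.ofFinite X
  have hc (r : X → Prop) : (Nat.card {x // r x} : ℤ) = ∑ x, if r x then 1 else 0 := by
    rw [Nat.card_eq_fintype_card, Fintype.card_subtype]
    simp
  simp only [hc, Finset.mul_sum]
  rw [Finset.sum_comm]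
  refine Finset.sum_congr rfl fun x _ => ?_
  have h := Finset.prod_sub (fun _ : ι => (1 : ℤ)) (fun i => if p i x then 1 else 0) Finset.univ
  by_cases hs : s x
  · simp only [hs, true_and]
    calc (if ∀ i, ¬ p i x then (1 : ℤ) else 0) = ∏ i, (1 - if p i x then (1 : ℤ) else 0) := by
          rw [← Fintype.prod_boole]
          exact Finset.prod_congr rfl fun i _ => by by_cases hp : p i x <;> simp [hp]
      _ = _ := by
          rw [h, Finset.powerset_univ]
          refine Finset.sum_congr rfl fun J _ => ?_
          rw [Finset.prod_const_one, mul_one, Finset.prod_boole]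
          congr
  · simp [hs]

/-- There exist `q₀` and a positive `ρ` such that for every `q > q₀` with
`gcd(q,ρ) = 1`, the complement count equals
`Σ_J (−1)^{|J|} q^{n − rank C_J}`, summed over those `J ⊆ {1,…,m}` with
`rank [C_J | c_J] = rank C_J` — i.e. the characteristic polynomial of the truncated
arrangement evaluated at `q`. -/
theorem statement3 {m n l : ℕ} (A : Matrix (Fin m) (Fin n) ℤ) (a : Fin m → ℤ)
    (B : Matrix (Fin l) (Fin n) ℤ) (b : Fin l → ℤ) :
    ∃ (q₀ : ℕ) (ρ : ℕ), 0 < ρ ∧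
      ∀ q : ℕ, q₀ < q → Nat.gcd q ρ = 1 →
        (Nat.card {x : Fin n → ZMod q //
            (∀ k, (B.map (Int.cast : ℤ → ZMod q)).mulVec x k = (b k : ZMod q)) ∧
            ∀ i, (A.map (Int.cast : ℤ → ZMod q)).mulVec x i ≠ (a i : ZMod q)} : ℤ) =
          ∑ J ∈ Finset.univ.filter (fun J : Finset (Fin m) =>
              rkQ (augM (stackJ B A J) (cvecJ b a J)) = rkQ (stackJ B A J)),
            (-1 : ℤ) ^ J.card * (q : ℤ) ^ (n - rkQ (stackJ B A J)) := by
  choose d hd hcard using fun J : Finset (Fin m) =>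
    exists_card_solutions_zmod (stackJ B A J) (cvecJ b a J)
  refine ⟨1, ∏ J, (d J).natAbs,
    Finset.prod_pos fun J _ => Int.natAbs_pos.2 (hd J), fun q hq hgcd => ?_⟩
  have : NeZero q := ⟨by omega⟩
  have hu (J : Finset (Fin m)) : IsUnit (d J : ZMod q) := by
    have h : Nat.Coprime (d J).natAbs q :=
      (Nat.Coprime.coprime_dvd_right (Finset.dvd_prod_of_mem _ (Finset.mem_univ J)) hgcd).symm
    have h' := (ZMod.isUnit_iff_coprime _ q).2 h
    rcases Int.natAbs_eq (d J) with e | e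
    · rw [e, Int.cast_natCast]; exact h'
    · rw [e, Int.cast_neg, Int.cast_natCast]; exact h'.neg
  rw [natCard_forall_not_eq_sum
    (fun x => ∀ k, (B.map (Int.cast : ℤ → ZMod q)).mulVec x k = (b k : ZMod q))
    (fun i x => (A.map (Int.cast : ℤ → ZMod q)).mulVec x i = (a i : ZMod q)),
    Finset.sum_filter]
  refine Finset.sum_congr rfl fun J _ => ?_
  have hJ := hcard J q hq (hu J)
  have heq : Nat.card {x : Fin n → ZMod q //
      (∀ k, (B.map (Int.cast : ℤ → ZMod q)).mulVec x k = (b k : ZMod q)) ∧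
      ∀ i ∈ J, (A.map (Int.cast : ℤ → ZMod q)).mulVec x i = (a i : ZMod q)} =
      Nat.card {x : Fin n → ZMod q //
        ∀ k, ((stackJ B A J).map (Int.cast : ℤ → ZMod q)).mulVec x k =
          (cvecJ b a J k : ZMod q)} := by
    refine Nat.card_congr (Equiv.subtypeEquivRight fun x => ?_)
    rw [Sum.forall, Subtype.forall]
    rfl
  rw [heq, hJ]
  split_ifs <;> simp
end

section
/- Let A' be the (m−1)×n integer matrix consisting of rows α_2ᵀ,…,α_mᵀ of A with 𝒂' := (a_2,…,a_m), let B' be the (l+1)×n matrix obtained by appending the row α_1ᵀ to the bottom of B, and let 𝒃' ∈ ℤ^{l+1} append a_1 to the bottom of 𝒃. Then for every positive integer q, N_{A',𝒂',B,𝒃}(q) = N_{A,𝒂,B,𝒃}(q) + N_{A',𝒂',B',𝒃'}(q) (deletion–restriction). -/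
open Matrix

/-- The complement count `N_{A,a,B,b}(q)`: the number of `x ∈ (ℤ/qℤ)^n` with
`[B]_q x = [b]_q` and `[αᵢ]_qᵀ x ≠ [aᵢ]_q` for every row `αᵢᵀ` of `A`. -/
noncomputable def Ncount {n : ℕ} {ι κ : Type*} [Fintype ι] [Fintype κ]
    (A : Matrix ι (Fin n) ℤ) (a : ι → ℤ) (B : Matrix κ (Fin n) ℤ) (b : κ → ℤ) (q : ℕ) : ℕ :=
  Nat.card {x : Fin n → ZMod q //
    (∀ k, (B.map (Int.cast : ℤ → ZMod q)).mulVec x k = (b k : ZMod q)) ∧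
    ∀ i, (A.map (Int.cast : ℤ → ZMod q)).mulVec x i ≠ (a i : ZMod q)}

/-- **deletion–restriction.** With `A'` the matrix of rows `α₂ᵀ,…,α_mᵀ` of
`A` (and `a'` correspondingly), `B'` obtained from `B` by appending the row `α₁ᵀ` at the
bottom, and `b'` appending `a₁` to `b`, one has
`N_{A',a',B,b}(q) = N_{A,a,B,b}(q) + N_{A',a',B',b'}(q)` for every `q > 0`. -/
theorem statement6 {m n l : ℕ} (A : Matrix (Fin (m + 1)) (Fin n) ℤ) (a : Fin (m + 1) → ℤ)
    (B : Matrix (Fin l) (Fin n) ℤ) (b : Fin l → ℤ) (q : ℕ) (hq : 0 < q) :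
    Ncount (A.submatrix Fin.succ id) (fun i => a i.succ) B b q =
      Ncount A a B b q +
        Ncount (A.submatrix Fin.succ id) (fun i => a i.succ)
          (Matrix.fromRows B (Matrix.of fun (_ : Unit) j => A 0 j))
          (Sum.elim b (fun _ : Unit => a 0)) q := by
  classical
  have : NeZero q := ⟨hq.ne'⟩
  have hrow : ∀ (x : Fin n → ZMod q) (i : Fin m),
      ((A.submatrix Fin.succ id).map (Int.cast : ℤ → ZMod q)).mulVec x i =
        (A.map (Int.cast : ℤ → ZMod q)).mulVec x i.succ := fun _ _ => rfl
  have hinl : ∀ (x : Fin n → ZMod q) (k : Fin l),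
      ((Matrix.fromRows B (Matrix.of fun (_ : Unit) j => A 0 j)).map
        (Int.cast : ℤ → ZMod q)).mulVec x (Sum.inl k) =
        (B.map (Int.cast : ℤ → ZMod q)).mulVec x k := fun _ _ => rfl
  have hinr : ∀ (x : Fin n → ZMod q) (u : Unit),
      ((Matrix.fromRows B (Matrix.of fun (_ : Unit) j => A 0 j)).map
        (Int.cast : ℤ → ZMod q)).mulVec x (Sum.inr u) =
        (A.map (Int.cast : ℤ → ZMod q)).mulVec x 0 := fun _ _ => rfl
  simp only [Ncount, Nat.card_eq_fintype_card, Fintype.card_subtype, Sum.forall, hrow, hinl, hinr,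
    Sum.elim_inl, Sum.elim_inr, Fin.forall_fin_succ (n := m), forall_const]
  rw [← Finset.card_union_of_disjoint]
  · congr 1
    ext x
    simp only [Finset.mem_filter, Finset.mem_univ, true_and, Finset.mem_union]
    tauto
  · rw [Finset.disjoint_filter]
    tauto
end

section
/- Let a and b be positive integers with gcd(a, ρ_C) = gcd(b, ρ_C). Then a and b are combinatorially equivalent: for every J ⊆ {1,…,m} with rank [C_J | c_J] = rank C_J, the system C_J x ≡ c_J (mod a) has a solution in (ℤ/aℤ)^n if and only if the system C_J x ≡ c_J (mod b) has a solution in (ℤ/bℤ)^n. -/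
open Matrix

/-- `g_k(M)`: the gcd of the (absolute values of) determinants of all `k×k` submatrices
of `M` (equal to `1` for `k = 0`). -/
noncomputable def minorGcd {ι κ : Type*} [Fintype ι] [Fintype κ] [DecidableEq ι] [DecidableEq κ]
    (M : Matrix ι κ ℤ) (k : ℕ) : ℕ :=
  Finset.gcd Finset.univ
    (fun p : (Fin k ↪ ι) × (Fin k ↪ κ) => (M.submatrix p.1 p.2).det.natAbs)

/-- The `k`-th invariant factor `d_k(M) = g_k(M) / g_{k−1}(M)`. -/
noncomputable def invFactor {ι κ : Type*} [Fintype ι] [Fintype κ] [DecidableEq ι] [DecidableEq κ]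
    (M : Matrix ι κ ℤ) (k : ℕ) : ℕ :=
  minorGcd M k / minorGcd M (k - 1)

/-- Solvability of the system `C x ≡ c (mod u)` in `(ℤ/uℤ)^n`. -/
def solvableMod {n : ℕ} {ι : Type*} [Fintype ι] (C : Matrix ι (Fin n) ℤ) (c : ι → ℤ)
    (u : ℕ) : Prop :=
  ∃ x : Fin n → ZMod u,
    ∀ i, (C.map (Int.cast : ℤ → ZMod u)).mulVec x i = (c i : ZMod u)

/-- `ρ_C`: the lcm of the maximal invariant factors `d_{rank C_J}(C_J)` over all
`J ⊆ {1,…,m}` with `rank [C_J | c_J] = rank C_J`. -/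
noncomputable def rhoC {m n l : ℕ} (A : Matrix (Fin m) (Fin n) ℤ) (a : Fin m → ℤ)
    (B : Matrix (Fin l) (Fin n) ℤ) (b : Fin l → ℤ) : ℕ :=
  Finset.lcm
    (Finset.univ.filter fun J : Finset (Fin m) =>
      rkQ (augM (stackJ B A J) (cvecJ b a J)) = rkQ (stackJ B A J))
    (fun J => invFactor (stackJ B A J) (rkQ (stackJ B A J)))

section InvariantFactor

variable {ι κ : Type*} [Fintype κ]

theorem range_mulVecLin_submatrix_eq {k : ℕ} (M : Matrix ι κ ℚ) (hk : M.rank = k)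
    (e : Fin k → ι) (f : Fin k → κ) (hdet : (M.submatrix e f).det ≠ 0) :
    LinearMap.range (M.submatrix id f).mulVecLin = LinearMap.range M.mulVecLin := by
  classical
  have hle : LinearMap.range (M.submatrix id f).mulVecLin ≤ LinearMap.range M.mulVecLin := by
    rw [range_mulVecLin, range_mulVecLin]
    refine Submodule.span_mono ?_
    rintro _ ⟨j, rfl⟩
    exact ⟨f j, rfl⟩
  have hinj : Function.Injective (M.submatrix id f).mulVecLin := by
    intro x y hxy
    refine mulVec_injective_of_isUnit
      ((isUnit_iff_isUnit_det (M.submatrix e f)).2 hdet.isUnit) ?_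
    ext i
    exact congrFun hxy (e i)
  refine Submodule.eq_of_le_of_finrank_eq hle ?_
  rw [LinearMap.finrank_range_of_inj hinj, ← Matrix.rank, hk]
  simp

variable [Fintype ι]

theorem mem_range_mulVecLin_of_rkQ_augM_eq {n : ℕ} {C : Matrix ι (Fin n) ℤ} {c : ι → ℤ}
    (h : rkQ (augM C c) = rkQ C) :
    (fun i => (c i : ℚ)) ∈ LinearMap.range (C.map (Int.cast : ℤ → ℚ)).mulVecLin := by
  have hle : LinearMap.range (C.map (Int.cast : ℤ → ℚ)).mulVecLin ≤
      LinearMap.range ((augM C c).map (Int.cast : ℤ → ℚ)).mulVecLin := by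
    rintro _ ⟨x, rfl⟩
    refine ⟨Sum.elim x 0, ?_⟩
    ext i
    simp [augM, mulVec, dotProduct]
  rw [Submodule.eq_of_le_of_finrank_eq hle h.symm]
  refine ⟨Sum.elim 0 1, ?_⟩
  ext i
  simp [augM, mulVec, dotProduct]

variable [DecidableEq ι] [DecidableEq κ]

theorem minorGcd_dvd_det {k : ℕ} (M : Matrix ι κ ℤ) (e : Fin k ↪ ι) (f : Fin k ↪ κ) :
    (minorGcd M k : ℤ) ∣ (M.submatrix e f).det :=
  Int.natCast_dvd.2 (Finset.gcd_dvd (f := fun p : (Fin k ↪ ι) × (Fin k ↪ κ) =>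
    (M.submatrix p.1 p.2).det.natAbs) (Finset.mem_univ (e, f)))

theorem minorGcd_pred_dvd_adjugate {k : ℕ} (M : Matrix ι κ ℤ) (e : Fin k ↪ ι) (f : Fin k ↪ κ)
    (i j : Fin k) : (minorGcd M (k - 1) : ℤ) ∣ (M.submatrix e f).adjugate i j := by
  cases k with
  | zero => exact i.elim0
  | succ k =>
    rw [adjugate_fin_succ_eq_det_submatrix]
    exact (minorGcd_dvd_det M (j.succAboveEmb.trans e)
      (i.succAboveEmb.trans f)).mul_left _

theorem minorGcd_pred_dvd (M : Matrix ι κ ℤ) (k : ℕ) : minorGcd M (k - 1) ∣ minorGcd M k := by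
  cases k with
  | zero => exact dvd_rfl
  | succ k =>
    refine Finset.dvd_gcd fun p _ => Int.natCast_dvd.1 ?_
    have h := congrFun (congrFun (mul_adjugate (M.submatrix p.1 p.2)) 0) 0
    rw [mul_apply, Matrix.smul_apply, one_apply_eq, smul_eq_mul, mul_one] at h
    rw [← h]
    exact Finset.dvd_sum fun j _ => (minorGcd_pred_dvd_adjugate M p.1 p.2 j 0).mul_left _

theorem natCast_minorGcd_mem (M : Matrix ι κ ℤ) (k : ℕ) (I : Ideal ℤ)
    (h : ∀ (e : Fin k ↪ ι) (f : Fin k ↪ κ), (M.submatrix e f).det ∈ I) :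
    (minorGcd M k : ℤ) ∈ I := by
  obtain ⟨t, rfl⟩ := (IsPrincipalIdealRing.principal I).principal
  simp only [← Ideal.span.eq_1, Ideal.mem_span_singleton] at h ⊢
  rw [← Int.natAbs_dvd]
  refine Int.natCast_dvd_natCast.2 (Finset.dvd_gcd fun p _ => ?_)
  exact Int.natAbs_dvd_natAbs.2 (h p.1 p.2)

/-- Cramer's rule for a rectangular system: a maximal minor times the right-hand side is
attained at a vector whose entries are combinations of minors of the next smaller size. -/
theorem exists_det_smul_eq_minorGcd_smul_mulVec (M : Matrix ι κ ℤ) (w : ι → ℤ)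
    (hw : (fun i => (w i : ℚ)) ∈ LinearMap.range (M.map (Int.cast : ℤ → ℚ)).mulVecLin)
    (e : Fin (rkQ M) ↪ ι) (f : Fin (rkQ M) ↪ κ) :
    ∃ x : κ → ℤ, (M.submatrix e f).det • w = (minorGcd M (rkQ M - 1) : ℤ) • M *ᵥ x := by
  by_cases hdet : (M.submatrix e f).det = 0
  · exact ⟨0, by simp [hdet]⟩
  set N := M.submatrix e f with hN
  have hcast : ((M.map (Int.cast : ℤ → ℚ)).submatrix e f).det = (N.det : ℚ) :=
    ((Int.castRingHom ℚ).map_det N).symm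
  rw [← range_mulVecLin_submatrix_eq (k := rkQ M) _ rfl e f
    (by rw [hcast]; exact_mod_cast hdet)] at hw
  obtain ⟨z, hz⟩ := hw
  choose adj hadj using minorGcd_pred_dvd_adjugate M e f
  set g : ℤ := (minorGcd M (rkQ M - 1) : ℤ)
  set y : Fin (rkQ M) → ℤ := fun i => ∑ j, adj i j * w (e j)
  have hy : ∀ i, (N.det : ℚ) * z i = g * y i := by
    intro i
    have h1 : (M.map (Int.cast : ℤ → ℚ)).submatrix e f *ᵥ z = fun j => (w (e j) : ℚ) := by
      ext j
      exact congrFun hz (e j)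
    have h2 := congrArg (fun v => ((M.map (Int.cast : ℤ → ℚ)).submatrix e f).adjugate *ᵥ v) h1
    simp only [mulVec_mulVec, adjugate_mul, hcast, smul_mulVec, one_mulVec] at h2
    have h3 := congrFun h2 i
    have h4 : ∀ j, ((M.map (Int.cast : ℤ → ℚ)).submatrix e f).adjugate i j = g * adj i j := by
      intro j
      have h5 := congrFun (congrFun ((Int.castRingHom ℚ).map_adjugate N) i) j
      have h6 : ((N.adjugate i j : ℤ) : ℚ) = g * adj i j := by
        rw [hN, hadj i j]; push_cast; rfl
      exact h5.symm.trans h6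
    simp only [Pi.smul_apply, smul_eq_mul, mulVec, dotProduct, h4] at h3
    rw [h3]
    simp only [y]
    push_cast
    rw [Finset.mul_sum]
    exact Finset.sum_congr rfl fun j _ => mul_assoc _ _ _
  refine ⟨∑ k, Pi.single (f k) (y k), ?_⟩
  ext i
  have hzi : ∑ k, (M i (f k) : ℚ) * z k = w i := congrFun hz i
  have hMy : (M *ᵥ ∑ k, Pi.single (f k) (y k)) i = ∑ k, M i (f k) * y k := by
    rw [mulVec_sum, Finset.sum_apply]
    exact Finset.sum_congr rfl fun k _ => by simp [mulVec_single]
  rw [Pi.smul_apply, Pi.smul_apply, hMy, smul_eq_mul, smul_eq_mul]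
  have : (N.det : ℚ) * w i = g * ∑ k, (M i (f k) : ℚ) * y k := by
    rw [← hzi, Finset.mul_sum, Finset.mul_sum]
    refine Finset.sum_congr rfl fun k _ => ?_
    linear_combination (M i (f k) : ℚ) * hy k
  exact_mod_cast this

/-- The maximal invariant factor of `M` annihilates the saturation of the column lattice of `M`
modulo that lattice. -/
theorem exists_invFactor_smul_eq_mulVec (M : Matrix ι κ ℤ) (w : ι → ℤ)
    (hw : (fun i => (w i : ℚ)) ∈ LinearMap.range (M.map (Int.cast : ℤ → ℚ)).mulVecLin) :
    ∃ x : κ → ℤ, (invFactor M (rkQ M) : ℤ) • w = M *ᵥ x := by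
  rcases Nat.eq_zero_or_pos (minorGcd M (rkQ M - 1)) with hg | hg
  · exact ⟨0, by simp [invFactor, hg]⟩
  let L : Submodule ℤ (ι → ℤ) :=
    LinearMap.range ((minorGcd M (rkQ M - 1) : ℤ) • M.mulVecLin)
  have hmem : (minorGcd M (rkQ M) : ℤ) ∈ L.comap (LinearMap.toSpanSingleton ℤ (ι → ℤ) w) := by
    refine natCast_minorGcd_mem M (rkQ M) _ fun e f => ?_
    obtain ⟨x, hx⟩ := exists_det_smul_eq_minorGcd_smul_mulVec M w hw e f
    exact ⟨x, hx.symm⟩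
  obtain ⟨x, hx⟩ := hmem
  replace hx : (minorGcd M (rkQ M - 1) : ℤ) • M *ᵥ x = (minorGcd M (rkQ M) : ℤ) • w := hx
  refine ⟨x, ?_⟩
  rw [← Nat.mul_div_cancel' (minorGcd_pred_dvd M (rkQ M)), Nat.cast_mul, mul_smul] at hx
  exact (smul_right_injective (ι → ℤ) (by exact_mod_cast hg.ne' :
    (minorGcd M (rkQ M - 1) : ℤ) ≠ 0) hx).symm

end InvariantFactor

section Solvability

variable {n : ℕ} {ι : Type*} [Fintype ι]

theorem solvableMod_iff_exists_int (C : Matrix ι (Fin n) ℤ) (c : ι → ℤ) (u : ℕ) :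
    solvableMod C c u ↔ ∃ (x : Fin n → ℤ) (w : ι → ℤ), C *ᵥ x = c + (u : ℤ) • w := by
  have hcast : ∀ (x : Fin n → ℤ) i, (C.map (Int.cast : ℤ → ZMod u)).mulVec
      (fun j => (x j : ZMod u)) i = ((C *ᵥ x) i : ZMod u) := by
    intro x i
    simp [mulVec, dotProduct]
  constructor
  · rintro ⟨x, hx⟩
    choose y hy using fun j => ZMod.intCast_surjective (x j)
    obtain rfl : (fun j => (y j : ZMod u)) = x := funext hy
    have hdvd : ∀ i, (u : ℤ) ∣ (C *ᵥ y) i - c i := fun i =>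
      (ZMod.intCast_eq_intCast_iff_dvd_sub _ _ _).1 (((hcast y i).symm.trans (hx i)).symm)
    choose w hw using hdvd
    refine ⟨y, w, funext fun i => ?_⟩
    rw [Pi.add_apply, Pi.smul_apply, smul_eq_mul, ← hw i]
    ring
  · rintro ⟨x, w, h⟩
    refine ⟨fun j => (x j : ZMod u), fun i => ?_⟩
    rw [hcast, h]
    simp

theorem solvableMod_iff_gcd_invFactor [DecidableEq ι] (C : Matrix ι (Fin n) ℤ) (c : ι → ℤ)
    (h : rkQ (augM C c) = rkQ C) {u : ℕ} (hu : 0 < u) :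
    solvableMod C c u ↔ solvableMod C c (Nat.gcd u (invFactor C (rkQ C))) := by
  set d := invFactor C (rkQ C) with hd
  simp only [solvableMod_iff_exists_int]
  constructor
  · rintro ⟨x, w, hx⟩
    obtain ⟨t, ht⟩ := Nat.gcd_dvd_left u d
    refine ⟨x, (t : ℤ) • w, ?_⟩
    rw [hx, smul_smul, ← Nat.cast_mul, ← ht]
  · rintro ⟨x, w, hx⟩
    have hg : (Nat.gcd u d : ℚ) ≠ 0 := by exact_mod_cast (Nat.gcd_pos_of_pos_left d hu).ne'
    have hw : (fun i => (w i : ℚ)) ∈ LinearMap.range (C.map (Int.cast : ℤ → ℚ)).mulVecLin := by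
      refine ((Submodule.smul_mem_iff _ hg).1 ?_)
      have hCx : (fun i => ((C *ᵥ x) i : ℚ)) ∈
          LinearMap.range (C.map (Int.cast : ℤ → ℚ)).mulVecLin := by
        refine ⟨fun j => (x j : ℚ), ?_⟩
        ext i
        simp [mulVec, dotProduct]
      convert Submodule.sub_mem _ hCx (mem_range_mulVecLin_of_rkQ_augM_eq h) using 1
      ext i
      simp [hx]
    obtain ⟨y, hy⟩ := exists_invFactor_smul_eq_mulVec C w hw
    rw [← hd] at hy
    refine ⟨x - (Nat.gcdB u d) • y, (Nat.gcdA u d) • w, ?_⟩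
    rw [mulVec_sub, mulVec_smul, ← hy, hx, Nat.gcd_eq_gcd_ab u d]
    module

end Solvability


/-- If `gcd(a, ρ_C) = gcd(b, ρ_C)` for positive integers `a`, `b`, then
`a` and `b` are combinatorially equivalent: for every `J` with
`rank [C_J | c_J] = rank C_J`, the system `C_J x ≡ c_J` is solvable mod `a` iff it is
solvable mod `b`. -/
theorem statement8 {m n l : ℕ} (A : Matrix (Fin m) (Fin n) ℤ) (a : Fin m → ℤ)
    (B : Matrix (Fin l) (Fin n) ℤ) (b : Fin l → ℤ)
    (u v : ℕ) (hu : 0 < u) (hv : 0 < v)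
    (hgcd : Nat.gcd u (rhoC A a B b) = Nat.gcd v (rhoC A a B b)) :
    ∀ J : Finset (Fin m),
      rkQ (augM (stackJ B A J) (cvecJ b a J)) = rkQ (stackJ B A J) →
      (solvableMod (stackJ B A J) (cvecJ b a J) u ↔
        solvableMod (stackJ B A J) (cvecJ b a J) v) := by
  intro J hJ
  have hdvd : invFactor (stackJ B A J) (rkQ (stackJ B A J)) ∣ rhoC A a B b :=
    Finset.dvd_lcm (f := fun J => invFactor (stackJ B A J) (rkQ (stackJ B A J)))
      (Finset.mem_filter.2 ⟨Finset.mem_univ J, hJ⟩)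
  have hgcd_eq : Nat.gcd u (invFactor (stackJ B A J) (rkQ (stackJ B A J))) =
      Nat.gcd v (invFactor (stackJ B A J) (rkQ (stackJ B A J))) := by
    rw [← Nat.gcd_eq_right hdvd, ← Nat.gcd_assoc, ← Nat.gcd_assoc, hgcd]
  rw [solvableMod_iff_gcd_invFactor _ _ hJ hu, solvableMod_iff_gcd_invFactor _ _ hJ hv, hgcd_eq]
end

section
/- Positive integers a and b are combinatorially equivalent if and only if gcd(a, ρ_C) and gcd(b, ρ_C) are combinatorially equivalent, where combinatorial equivalence of positive integers u,v means: for every J ⊆ {1,…,m} with rank [C_J | c_J] = rank C_J, the system C_J x ≡ c_J (mod u) has a solution if and only if the system C_J x ≡ c_J (mod v) has a solution. -/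
open Matrix

/-- Combinatorial equivalence of positive integers `u`, `v` with respect to the truncated
arrangement: for every `J ⊆ {1,…,m}` with `rank [C_J | c_J] = rank C_J`, the system
`C_J x ≡ c_J (mod u)` is solvable iff the system `C_J x ≡ c_J (mod v)` is solvable. -/
def combEquiv {m n l : ℕ} (A : Matrix (Fin m) (Fin n) ℤ) (a : Fin m → ℤ)
    (B : Matrix (Fin l) (Fin n) ℤ) (b : Fin l → ℤ) (u v : ℕ) : Prop :=
  ∀ J : Finset (Fin m),
    rkQ (augM (stackJ B A J) (cvecJ b a J)) = rkQ (stackJ B A J) →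
    (solvableMod (stackJ B A J) (cvecJ b a J) u ↔
      solvableMod (stackJ B A J) (cvecJ b a J) v)

theorem Matrix.dvd_det_mul_of_forall_dvd_det_submatrix_rows {ι R : Type*} [Fintype ι] [CommRing R]
    {k : ℕ} (X : Matrix (Fin k) ι R) (Y : Matrix ι (Fin k) R) (N : R)
    (h : ∀ p : Fin k ↪ ι, N ∣ (Y.submatrix p id).det) : N ∣ (X * Y).det := by
  have hrows : X * Y = fun i => ∑ s, X i s • Y s := by
    ext i j
    simp [Matrix.mul_apply, Finset.sum_apply]
  have hexp : (X * Y).det = ∑ p : Fin k → ι, (∏ i, X i (p i)) * (Y.submatrix p id).det := by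
    rw [hrows]
    change (detRowAlternating : AlternatingMap R (Fin k → R) R (Fin k)).toMultilinearMap
      (fun i => ∑ s, X i s • Y s) = _
    rw [MultilinearMap.map_sum]
    refine Finset.sum_congr rfl fun p _ => ?_
    rw [MultilinearMap.map_smul_univ, smul_eq_mul]
    rfl
  rw [hexp]
  refine Finset.dvd_sum fun p _ => Dvd.dvd.mul_left ?_ _
  by_cases hp : Function.Injective p
  · exact h ⟨p, hp⟩
  · obtain ⟨i, j, hij, hne⟩ := Function.not_injective_iff.mp hp
    rw [det_zero_of_row_eq hne (by ext s; simp [hij])]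
    exact dvd_zero N

theorem Matrix.dvd_det_mul_mul_of_forall_dvd_det_submatrix {ι κ R : Type*} [Fintype ι]
    [Fintype κ] [CommRing R] {k : ℕ} (L : Matrix (Fin k) ι R) (C : Matrix ι κ R)
    (S : Matrix κ (Fin k) R) (N : R)
    (h : ∀ (p : Fin k ↪ ι) (q : Fin k ↪ κ), N ∣ (C.submatrix p q).det) :
    N ∣ (L * C * S).det := by
  rw [Matrix.mul_assoc]
  refine dvd_det_mul_of_forall_dvd_det_submatrix_rows L (C * S) N fun p => ?_
  have hsub : (C * S).submatrix p id = C.submatrix p id * S := by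
    ext i j
    simp [Matrix.mul_apply]
  rw [hsub, ← det_transpose, transpose_mul]
  refine dvd_det_mul_of_forall_dvd_det_submatrix_rows Sᵀ (C.submatrix p id)ᵀ N fun q => ?_
  rw [← det_transpose]
  exact h p q

/-- A diagonalization of an integer matrix, with the unimodular transformations truncated to the
nonzero diagonal entries. -/
theorem Matrix.exists_eq_mul_diagonal_mul {ι κ : Type*} [Fintype ι] [Fintype κ] [DecidableEq ι]
    [DecidableEq κ] (C : Matrix ι κ ℤ) :
    ∃ (r : ℕ) (P : Matrix ι (Fin r) ℤ) (Q : Matrix (Fin r) κ ℤ) (L : Matrix (Fin r) ι ℤ)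
      (S : Matrix κ (Fin r) ℤ) (d : Fin r → ℤ),
      C = P * diagonal d * Q ∧ L * P = 1 ∧ Q * S = 1 ∧ ∀ j, d j ≠ 0 := by
  obtain ⟨r, bM, bN, f, d, snf⟩ :=
    Submodule.smithNormalForm (Pi.basisFun ℤ ι) (LinearMap.range C.mulVecLin)
  have hy : ∀ j, ∃ y : κ → ℤ, C *ᵥ y = bN j := fun j => (bN j).2
  choose y hy using hy
  refine ⟨r, Matrix.of fun i j => bM (f j) i,
    LinearMap.toMatrix' (bN.equivFun.toLinearMap ∘ₗ C.mulVecLin.rangeRestrict),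
    LinearMap.toMatrix' (LinearMap.pi fun j => bM.coord (f j)),
    Matrix.of fun i j => y j i, d, ?_, ?_, ?_, ?_⟩
  · refine Matrix.toLin'.injective (LinearMap.ext fun x => ?_)
    rw [toLin'_apply, toLin'_apply]
    rw [← Matrix.mulVec_mulVec, LinearMap.toMatrix'_mulVec, ← Matrix.mulVec_mulVec]
    have hsum := congrArg Subtype.val (bN.sum_equivFun (C.mulVecLin.rangeRestrict x))
    rw [AddSubmonoidClass.coe_finsetSum] at hsum
    change _ = C *ᵥ x at hsum
    rw [← hsum]
    ext s
    simp [Matrix.mulVec, dotProduct, Finset.sum_apply, snf, diagonal_apply]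
    refine Finset.sum_congr rfl fun j _ => by ring
  · ext j k
    have h := congrFun (LinearMap.toMatrix'_mulVec (LinearMap.pi fun j => bM.coord (f j))
      (bM (f k))) j
    refine h.trans ?_
    simp [Finsupp.single_apply, Matrix.one_apply, eq_comm]
  · ext j k
    have h := congrFun (LinearMap.toMatrix'_mulVec
      (bN.equivFun.toLinearMap ∘ₗ C.mulVecLin.rangeRestrict) (y k)) j
    refine h.trans ?_
    have : C.mulVecLin.rangeRestrict (y k) = bN k := Subtype.ext (hy k)
    simp [this, Matrix.one_apply, eq_comm]
  · intro j hj
    have h := snf j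
    rw [hj, zero_smul] at h
    exact bN.ne_zero j (Subtype.ext h)

theorem rkQ_mul_diagonal_mul {ι κ : Type*} [Fintype ι] [Fintype κ] {r : ℕ}
    {P : Matrix ι (Fin r) ℤ} {Q : Matrix (Fin r) κ ℤ} {L : Matrix (Fin r) ι ℤ}
    {S : Matrix κ (Fin r) ℤ} {d : Fin r → ℤ} (hLP : L * P = 1) (hQS : Q * S = 1)
    (hd : ∀ j, d j ≠ 0) : rkQ (P * diagonal d * Q) = r := by
  let φ : ℤ →+* ℚ := Int.castRingHom ℚ
  have hφ : rkQ (P * diagonal d * Q) = ((P * diagonal d * Q).map φ).rank := rfl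
  rw [hφ]
  apply le_antisymm
  · rw [Matrix.map_mul]
    exact (rank_mul_le_right ((P * diagonal d).map φ) (Q.map φ)).trans
      ((rank_le_card_height (Q.map φ)).trans_eq (Fintype.card_fin r))
  · have hdiag : L * (P * diagonal d * Q) * S = diagonal d := by
      rw [Matrix.mul_assoc P, ← Matrix.mul_assoc L, hLP, Matrix.one_mul, Matrix.mul_assoc, hQS,
        Matrix.mul_one]
    have hrank : ((L * (P * diagonal d * Q) * S).map φ).rank = r := by
      rw [hdiag, diagonal_map (map_zero φ), rank_diagonal]
      simp [hd]
    rw [Matrix.map_mul, Matrix.map_mul] at hrank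
    refine hrank.ge.trans ?_
    exact (rank_mul_le_left (L.map φ * (P * diagonal d * Q).map φ) (S.map φ)).trans
      (rank_mul_le_right (L.map φ) ((P * diagonal d * Q).map φ))

theorem natCast_minorGcd_dvd_det_mul_mul {ι κ : Type*} [Fintype ι] [Fintype κ] [DecidableEq ι]
    [DecidableEq κ] (C : Matrix ι κ ℤ) {k : ℕ} (L : Matrix (Fin k) ι ℤ)
    (S : Matrix κ (Fin k) ℤ) : (minorGcd C k : ℤ) ∣ (L * C * S).det :=
  dvd_det_mul_mul_of_forall_dvd_det_submatrix L C S _ fun p q =>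
    Int.natCast_dvd.mpr (Finset.gcd_dvd (Finset.mem_univ (p, q)))

/-- Every diagonal entry of a diagonalization divides the maximal invariant factor. -/
theorem diagonal_entry_dvd_invFactor {ι κ : Type*} [Fintype ι] [Fintype κ] [DecidableEq ι]
    [DecidableEq κ] {r : ℕ} {C : Matrix ι κ ℤ}
    {P : Matrix ι (Fin r) ℤ} {Q : Matrix (Fin r) κ ℤ} {L : Matrix (Fin r) ι ℤ}
    {S : Matrix κ (Fin r) ℤ} {d : Fin r → ℤ} (hC : C = P * diagonal d * Q) (hLP : L * P = 1)
    (hQS : Q * S = 1) (j : Fin r) : d j ∣ (invFactor C r : ℤ) := by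
  have hprod : (∏ i, d i).natAbs ∣ minorGcd C r := by
    refine Finset.dvd_gcd fun pq _ => Int.natAbs_dvd_natAbs.mpr ?_
    have hsub : C.submatrix pq.1 pq.2 =
        P.submatrix pq.1 id * diagonal d * Q.submatrix id pq.2 := by
      rw [hC]
      ext i k
      simp [Matrix.mul_apply]
    rw [hsub, det_mul, det_mul, det_diagonal]
    exact (dvd_mul_left _ _).mul_right _
  have hdiag : L * C * S = diagonal d := by
    rw [hC, Matrix.mul_assoc P, ← Matrix.mul_assoc L, hLP, Matrix.one_mul, Matrix.mul_assoc, hQS,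
      Matrix.mul_one]
  cases r with
  | zero => exact j.elim0
  | succ k =>
    have hminor : (minorGcd C k : ℤ) ∣ ∏ i, d (j.succAbove i) := by
      have h := natCast_minorGcd_dvd_det_mul_mul C (L.submatrix j.succAbove id)
        (S.submatrix id j.succAbove)
      have hsub : L.submatrix j.succAbove id * C * S.submatrix id j.succAbove =
          diagonal fun i => d (j.succAbove i) := by
        have h' : L.submatrix j.succAbove id * C * S.submatrix id j.succAbove =
            (L * C * S).submatrix j.succAbove j.succAbove := by
          ext i k
          simp [Matrix.mul_apply]
        rw [h', hdiag, submatrix_diagonal _ _ Fin.succAbove_right_injective]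
        rfl
      rwa [hsub, det_diagonal] at h
    rw [← Int.natAbs_dvd_natAbs, Int.natAbs_natCast, invFactor, Nat.add_sub_cancel]
    apply Nat.dvd_div_of_mul_dvd
    refine dvd_trans ?_ hprod
    rw [Fin.prod_univ_succAbove d j, Int.natAbs_mul, mul_comm]
    exact mul_dvd_mul_left _ (Int.natCast_dvd.mp hminor)

theorem exists_mulVec_eq_of_rkQ_augM_eq {n : ℕ} {ι : Type*} [Fintype ι]
    {C : Matrix ι (Fin n) ℤ} {c : ι → ℤ} (h : rkQ (augM C c) = rkQ C) :
    ∃ x : Fin n → ℚ, C.map (Int.cast : ℤ → ℚ) *ᵥ x = fun i => (c i : ℚ) := by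
  have hle : LinearMap.range (C.map (Int.cast : ℤ → ℚ)).mulVecLin ≤
      LinearMap.range ((augM C c).map (Int.cast : ℤ → ℚ)).mulVecLin := by
    rintro _ ⟨x, rfl⟩
    refine ⟨Sum.elim x 0, ?_⟩
    ext i
    simp [augM, mulVec, dotProduct]
  have heq := Submodule.eq_of_le_of_finrank_eq hle h.symm
  have hmem : (fun i => (c i : ℚ)) ∈
      LinearMap.range ((augM C c).map (Int.cast : ℤ → ℚ)).mulVecLin := by
    refine ⟨Sum.elim 0 1, ?_⟩
    ext i
    simp [augM, mulVec, dotProduct]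
  rwa [← heq] at hmem

theorem solvableMod_iff_exists {n : ℕ} {ι : Type*} [Fintype ι] (C : Matrix ι (Fin n) ℤ)
    (c : ι → ℤ) (u : ℕ) :
    solvableMod C c u ↔ ∃ (x : Fin n → ℤ) (z : ι → ℤ), c = C *ᵥ x + (u : ℤ) • z := by
  have hcast : ∀ (x : Fin n → ℤ) (i : ι),
      (C.map (Int.cast : ℤ → ZMod u) *ᵥ fun k => (x k : ZMod u)) i =
        (((C *ᵥ x) i : ℤ) : ZMod u) := fun x i =>
    ((Int.castRingHom (ZMod u)).map_mulVec C x i).symm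
  constructor
  · rintro ⟨x, hx⟩
    choose y hy using fun k => ZMod.intCast_surjective (x k)
    obtain rfl : (fun k => (y k : ZMod u)) = x := funext hy
    have hdvd : ∀ i, (u : ℤ) ∣ c i - (C *ᵥ y) i := fun i =>
      (ZMod.intCast_eq_intCast_iff_dvd_sub _ _ _).mp ((hcast y i).symm.trans (hx i))
    choose z hz using hdvd
    refine ⟨y, z, funext fun i => ?_⟩
    simp only [Pi.add_apply, Pi.smul_apply, smul_eq_mul, ← hz]
    ring
  · rintro ⟨x, z, h⟩
    refine ⟨fun k => (x k : ZMod u), fun i => ?_⟩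
    rw [hcast, h]
    simp

/-- Reducing the modulus to its gcd with a multiple of the maximal invariant factor preserves
solvability of a rationally consistent system. -/
theorem solvableMod_gcd_iff {n : ℕ} {ι : Type*} [Fintype ι] [DecidableEq ι]
    {C : Matrix ι (Fin n) ℤ} {c : ι → ℤ} (h : rkQ (augM C c) = rkQ C) {u ρ : ℕ} (hu : 0 < u)
    (hρ : invFactor C (rkQ C) ∣ ρ) : solvableMod C c (u.gcd ρ) ↔ solvableMod C c u := by
  rw [solvableMod_iff_exists, solvableMod_iff_exists]
  constructor
  · rintro ⟨x, z, hz⟩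
    obtain ⟨r, P, Q, L, S, d, hC, hLP, hQS, hd⟩ := C.exists_eq_mul_diagonal_mul
    have hrk : rkQ C = r := by rw [hC]; exact rkQ_mul_diagonal_mul hLP hQS hd
    rw [hrk] at hρ
    have hPLC : P * L * C = C := by
      rw [hC, Matrix.mul_assoc P L, Matrix.mul_assoc P (diagonal d), ← Matrix.mul_assoc L, hLP,
        Matrix.one_mul]
    have hPLc : (P * L) *ᵥ c = c := by
      obtain ⟨y, hy⟩ := exists_mulVec_eq_of_rkQ_augM_eq h
      have hPLC' : (P * L).map (Int.cast : ℤ → ℚ) * C.map (Int.cast : ℤ → ℚ) =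
          C.map (Int.cast : ℤ → ℚ) := by
        conv_rhs => rw [← hPLC]
        exact (Matrix.map_mul (f := Int.castRingHom ℚ)).symm
      have hfix := congrArg (· *ᵥ y) hPLC'
      simp only [← mulVec_mulVec, hy] at hfix
      ext i
      have hi := (Int.castRingHom ℚ).map_mulVec (P * L) c i
      exact Int.cast_injective (α := ℚ) (hi.trans (congrFun hfix i))
    have hPLz : (P * L) *ᵥ z = z := by
      have hg : ((u.gcd ρ : ℕ) : ℤ) ≠ 0 := by
        exact_mod_cast (Nat.gcd_pos_of_pos_left ρ hu).ne'
      have hzc : ((u.gcd ρ : ℕ) : ℤ) • z = c - C *ᵥ x := by rw [hz]; simp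
      refine smul_right_injective _ hg ?_
      change _ • _ = _ • _
      rw [← mulVec_smul, hzc, mulVec_sub, hPLc, mulVec_mulVec, hPLC]
    have hdvd : ∀ j, d j ∣ (ρ : ℤ) := fun j =>
      (diagonal_entry_dvd_invFactor hC hLP hQS j).trans (Int.natCast_dvd_natCast.mpr hρ)
    choose e he using hdvd
    have hρz : C *ᵥ (S *ᵥ fun j => e j * (L *ᵥ z) j) = (ρ : ℤ) • z := by
      rw [mulVec_mulVec, hC, Matrix.mul_assoc, hQS, Matrix.mul_one, ← mulVec_mulVec]
      have hdiag : (diagonal d *ᵥ fun j => e j * (L *ᵥ z) j) = (ρ : ℤ) • (L *ᵥ z) := by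
        ext j
        rw [mulVec_diagonal, Pi.smul_apply, smul_eq_mul, he j, mul_assoc]
      rw [hdiag, mulVec_smul, mulVec_mulVec, hPLz]
    refine ⟨x + u.gcdB ρ • (S *ᵥ fun j => e j * (L *ᵥ z) j), u.gcdA ρ • z, ?_⟩
    rw [mulVec_add, mulVec_smul, hρz, add_assoc, smul_smul, smul_smul, ← add_smul]
    conv_lhs => rw [hz, Nat.gcd_eq_gcd_ab]
    ring_nf
  · rintro ⟨x, z, hz⟩
    obtain ⟨t, ht⟩ := Nat.gcd_dvd_left u ρ
    refine ⟨x, (t : ℤ) • z, ?_⟩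
    rw [smul_smul, ← Nat.cast_mul, ← ht]
    exact hz

/-- Positive integers `a`, `b` are combinatorially equivalent iff
`gcd(a, ρ_C)` and `gcd(b, ρ_C)` are combinatorially equivalent. -/
theorem statement9 {m n l : ℕ} (A : Matrix (Fin m) (Fin n) ℤ) (a : Fin m → ℤ)
    (B : Matrix (Fin l) (Fin n) ℤ) (b : Fin l → ℤ)
    (u v : ℕ) (hu : 0 < u) (hv : 0 < v) :
    combEquiv A a B b u v ↔
      combEquiv A a B b (Nat.gcd u (rhoC A a B b)) (Nat.gcd v (rhoC A a B b)) := by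
  refine forall_congr' fun J => forall_congr' fun hJ => ?_
  have hρ : invFactor (stackJ B A J) (rkQ (stackJ B A J)) ∣ rhoC A a B b :=
    Finset.dvd_lcm (f := fun J => invFactor (stackJ B A J) (rkQ (stackJ B A J)))
      (Finset.mem_filter.mpr ⟨Finset.mem_univ J, hJ⟩)
  rw [solvableMod_gcd_iff hJ hu hρ, solvableMod_gcd_iff hJ hv hρ]
end

section
/- Let M be an m×n integer matrix of rank r over ℚ, with P ∈ GL_m(ℤ), Q ∈ GL_n(ℤ), and positive integers d_1 ∣ d_2 ∣ ⋯ ∣ d_r such that PMQ is the diagonal matrix with diagonal entries d_1,…,d_r followed by zeros. Let c ∈ ℤ^m and let p, q be positive integers such that the system Mx ≡ c (mod pq) has a solution. Then the entrywise reduction map (ℤ/pqℤ)^n → (ℤ/qℤ)^n maps {x ∈ (ℤ/pqℤ)^n : [M]_{pq} x = [c]_{pq}} onto {x ∈ (ℤ/qℤ)^n : [M]_q x = [c]_q} if and only if gcd(p, d_i) · gcd(q, d_i) divides d_i for every i = 1,…,r. -/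
open Matrix

/-- Every integer solution of `A z ≡ 0 (mod q)` is congruent modulo `q` to a solution of
`A z ≡ 0 (mod pq)`. -/
def KernelLifts {m n : ℕ} (A : Matrix (Fin m) (Fin n) ℤ) (p q : ℤ) : Prop :=
  ∀ z : Fin n → ℤ, (∀ i, q ∣ (A *ᵥ z) i) → ∃ t : Fin n → ℤ, ∀ i, p * q ∣ (A *ᵥ (z + q • t)) i

lemma dvd_mulVec {m n : ℕ} (A : Matrix (Fin m) (Fin n) ℤ) {N : ℤ} {z : Fin n → ℤ}
    (h : ∀ j, N ∣ z j) (i : Fin m) : N ∣ (A *ᵥ z) i :=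
  Finset.dvd_sum (s := Finset.univ) fun j _ => (h j).mul_left (A i j)

lemma KernelLifts.mul_mul {m n : ℕ} {A : Matrix (Fin m) (Fin n) ℤ} {p q : ℤ}
    (h : KernelLifts A p q) {P : Matrix (Fin m) (Fin m) ℤ} {Q : Matrix (Fin n) (Fin n) ℤ}
    (hP : IsUnit P.det) (hQ : IsUnit Q.det) : KernelLifts (P * A * Q) p q := by
  intro z hz
  obtain ⟨t, ht⟩ := h (Q *ᵥ z) (by
    have := dvd_mulVec P⁻¹ hz
    simpa [Matrix.mulVec_mulVec, Matrix.mul_assoc, Matrix.nonsing_inv_mul_cancel_left _ _ hP]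
      using this)
  refine ⟨Q⁻¹ *ᵥ t, ?_⟩
  have := dvd_mulVec P ht
  have e : (P * A * Q) *ᵥ (z + q • Q⁻¹ *ᵥ t) = P *ᵥ (A *ᵥ (Q *ᵥ z + q • t)) := by
    simp only [Matrix.mulVec_add, Matrix.mulVec_smul, Matrix.mulVec_mulVec, Matrix.mul_assoc,
      Matrix.mul_nonsing_inv _ hQ, Matrix.mul_one]
  rwa [e]

lemma kernelLifts_mul_mul_iff {m n : ℕ} (A : Matrix (Fin m) (Fin n) ℤ) (p q : ℤ)
    {P : Matrix (Fin m) (Fin m) ℤ} {Q : Matrix (Fin n) (Fin n) ℤ}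
    (hP : IsUnit P.det) (hQ : IsUnit Q.det) : KernelLifts (P * A * Q) p q ↔ KernelLifts A p q := by
  refine ⟨fun h => ?_, fun h => h.mul_mul hP hQ⟩
  have := h.mul_mul (P.isUnit_nonsing_inv_det hP) (Q.isUnit_nonsing_inv_det hQ)
  simpa [Matrix.mul_assoc, Matrix.nonsing_inv_mul_cancel_left _ _ hP, Matrix.mul_nonsing_inv _ hQ]
    using this

lemma forall_exists_dvd_mul_add_iff {p q d : ℤ} (hq : q ≠ 0) :
    (∀ w, q ∣ d * w → ∃ s, p * q ∣ d * (w + q * s)) ↔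
      (Int.gcd p d : ℤ) * (Int.gcd q d : ℤ) ∣ d := by
  have hg : (Int.gcd q d : ℤ) ≠ 0 := by simp [Int.gcd_eq_zero_iff, hq]
  have hqg : (Int.gcd q d : ℤ) ∣ q := Int.gcd_dvd_left ..
  have hdg : (Int.gcd q d : ℤ) ∣ d := Int.gcd_dvd_right ..
  have hbez := Int.gcd_eq_gcd_ab q d
  generalize (Int.gcd q d : ℤ) = g at *
  obtain ⟨k, rfl⟩ := hqg
  obtain ⟨e, rfl⟩ := hdg
  have hk : k ≠ 0 := right_ne_zero_of_mul hq
  rw [mul_comm _ g, mul_dvd_mul_iff_left hg]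
  constructor
  · intro h
    obtain ⟨s, hs⟩ := h k ⟨e, by ring⟩
    have hpe : p ∣ e * (1 + g * s) := by
      rw [← mul_dvd_mul_iff_right hq]
      rwa [show e * (1 + g * s) * (g * k) = g * e * (k + g * k * s) by ring]
    have h1 : (Int.gcd p (g * e) : ℤ) ∣ e * (1 + g * s) := (Int.gcd_dvd_left ..).trans hpe
    have h2 : (Int.gcd p (g * e) : ℤ) ∣ g * e * s := (Int.gcd_dvd_right ..).mul_right s
    have h3 := dvd_sub h1 h2
    rwa [show e * (1 + g * s) - g * e * s = e by ring] at h3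
  · intro h w hw
    have hcop : IsCoprime k e := by
      refine ⟨Int.gcdA (g * k) (g * e), Int.gcdB (g * k) (g * e), mul_left_cancel₀ hg ?_⟩
      linear_combination -hbez
    obtain ⟨u, rfl⟩ : k ∣ w := by
      rw [mul_assoc, mul_dvd_mul_iff_left hg] at hw
      exact hcop.dvd_of_dvd_mul_left hw
    obtain ⟨v, hv⟩ := h
    have hb := Int.gcd_eq_gcd_ab p (g * e)
    generalize Int.gcdA p (g * e) = a at hb
    generalize Int.gcdB p (g * e) = b at hb
    refine ⟨-(b * v * u), a * v * u, ?_⟩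
    rw [hb] at hv
    linear_combination g * k * u * hv

lemma kernelLifts_diag_iff {m n r : ℕ} (hm : r ≤ m) (hn : r ≤ n) (d : ℕ → ℤ) (p q : ℤ) :
    KernelLifts (Matrix.of (fun (i : Fin m) (j : Fin n) =>
      if (i : ℕ) = (j : ℕ) ∧ (i : ℕ) < r then d (i : ℕ) else 0)) p q ↔
    ∀ i, i < r → ∀ w, q ∣ d i * w → ∃ s, p * q ∣ d i * (w + q * s) := by
  have hlt : ∀ (i : Fin m) (hi : (i : ℕ) < r) (z : Fin n → ℤ),
      (Matrix.of (fun (i : Fin m) (j : Fin n) =>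
        if (i : ℕ) = (j : ℕ) ∧ (i : ℕ) < r then d (i : ℕ) else 0) *ᵥ z) i =
        d i * z ⟨i, hi.trans_le hn⟩ := by
    intro i hi z
    rw [Matrix.mulVec, dotProduct, Finset.sum_eq_single ⟨i, hi.trans_le hn⟩]
    · simp [hi]
    · intro j _ hj
      have : (i : ℕ) ≠ j := fun h => hj (Fin.ext h.symm)
      simp [this]
    · simp
  have hge : ∀ (i : Fin m) (hi : ¬ (i : ℕ) < r) (z : Fin n → ℤ),
      (Matrix.of (fun (i : Fin m) (j : Fin n) =>
        if (i : ℕ) = (j : ℕ) ∧ (i : ℕ) < r then d (i : ℕ) else 0) *ᵥ z) i = 0 := by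
    intro i hi z
    simp [Matrix.mulVec, dotProduct, hi]
  constructor
  · intro h i hi w hw
    obtain ⟨t, ht⟩ := h (Pi.single ⟨i, hi.trans_le hn⟩ w) (by
      intro j
      by_cases hj : (j : ℕ) < r
      · rw [hlt j hj]
        by_cases hji : (j : ℕ) = i
        · simpa [hji] using hw
        · simp [hji]
      · simp [hge j hj])
    have := ht ⟨i, hi.trans_le hm⟩
    rw [hlt _ hi] at this
    exact ⟨t ⟨i, hi.trans_le hn⟩, by simpa using this⟩
  · intro h z hz
    have hs : ∀ j : Fin n, ∃ s, (j : ℕ) < r → p * q ∣ d j * (z j + q * s) := by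
      intro j
      by_cases hj : (j : ℕ) < r
      · have := hz ⟨j, hj.trans_le hm⟩
        rw [hlt _ hj] at this
        obtain ⟨s, hs⟩ := h j hj (z j) this
        exact ⟨s, fun _ => hs⟩
      · exact ⟨0, fun h => absurd h hj⟩
    choose t ht using hs
    refine ⟨t, fun i => ?_⟩
    by_cases hi : (i : ℕ) < r
    · rw [hlt i hi]
      simpa using ht ⟨i, hi.trans_le hn⟩ hi
    · simp [hge i hi]

lemma map_intCast_mulVec_eq_iff {m n : ℕ} (A : Matrix (Fin m) (Fin n) ℤ) (N : ℕ)
    (x : Fin n → ℤ) (c : Fin m → ℤ) (i : Fin m) :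
    (A.map (Int.cast : ℤ → ZMod N)).mulVec (fun j => (x j : ZMod N)) i = (c i : ZMod N) ↔
      (N : ℤ) ∣ (A *ᵥ x) i - c i := by
  rw [← ZMod.intCast_zmod_eq_zero_iff_dvd, Int.cast_sub, sub_eq_zero]
  simp [Matrix.mulVec, dotProduct]

lemma exists_intCast_eq {n N : ℕ} (x : Fin n → ZMod N) :
    ∃ y : Fin n → ℤ, (fun j => (y j : ZMod N)) = x :=
  ⟨fun j => (x j).cast, by simp⟩

lemma image_castHom_eq_iff_kernelLifts {m n : ℕ} (M : Matrix (Fin m) (Fin n) ℤ)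
    (c : Fin m → ℤ) (p q : ℕ)
    (hsol : ∃ x : Fin n → ZMod (p * q),
      ∀ i, (M.map (Int.cast : ℤ → ZMod (p * q))).mulVec x i = (c i : ZMod (p * q))) :
    ((fun (x : Fin n → ZMod (p * q)) (j : Fin n) =>
        ZMod.castHom (dvd_mul_left q p) (ZMod q) (x j)) ''
      {x : Fin n → ZMod (p * q) |
        ∀ i, (M.map (Int.cast : ℤ → ZMod (p * q))).mulVec x i = (c i : ZMod (p * q))} =
      {x : Fin n → ZMod q |
        ∀ i, (M.map (Int.cast : ℤ → ZMod q)).mulVec x i = (c i : ZMod q)}) ↔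
    KernelLifts M p q := by
  obtain ⟨x₀, hx₀⟩ := hsol
  obtain ⟨x₀, rfl⟩ := exists_intCast_eq x₀
  simp only [map_intCast_mulVec_eq_iff, Nat.cast_mul] at hx₀
  have hx₀q : ∀ i, (q : ℤ) ∣ (M *ᵥ x₀) i - c i := fun i => (dvd_mul_left _ _).trans (hx₀ i)
  constructor
  · intro h z hz
    have hmem : (fun j => ((x₀ + z) j : ZMod q)) ∈ {x : Fin n → ZMod q |
        ∀ i, (M.map (Int.cast : ℤ → ZMod q)).mulVec x i = (c i : ZMod q)} := by
      intro i
      rw [map_intCast_mulVec_eq_iff, Matrix.mulVec_add, Pi.add_apply, add_sub_right_comm]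
      exact dvd_add (hx₀q i) (hz i)
    rw [← h] at hmem
    obtain ⟨x, hx, hxe⟩ := hmem
    obtain ⟨x, rfl⟩ := exists_intCast_eq x
    simp only [Set.mem_ofPred_eq, map_intCast_mulVec_eq_iff, Nat.cast_mul] at hx
    have ht : ∀ j, ∃ t, x j = (x₀ + z) j + q * t := by
      intro j
      have := congrFun hxe j
      simp only [map_intCast] at this
      obtain ⟨t, ht⟩ := (ZMod.intCast_eq_intCast_iff_dvd_sub _ _ _).1 this.symm
      exact ⟨t, by rw [← ht]; ring⟩
    choose t ht using ht
    refine ⟨t, fun i => ?_⟩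
    have e : z + (q : ℤ) • t = x - x₀ := by
      ext j
      simp only [Pi.add_apply, Pi.sub_apply, Pi.smul_apply, smul_eq_mul, ht j]
      ring
    rw [e, Matrix.mulVec_sub]
    simpa using dvd_sub (hx i) (hx₀ i)
  · intro h
    apply Set.Subset.antisymm
    · rintro _ ⟨x, hx, rfl⟩
      obtain ⟨x, rfl⟩ := exists_intCast_eq x
      intro i
      have := hx i
      rw [map_intCast_mulVec_eq_iff, Nat.cast_mul] at this
      simp only [map_intCast]
      exact (map_intCast_mulVec_eq_iff ..).2 ((dvd_mul_left _ _).trans this)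
    · intro x hx
      obtain ⟨x, rfl⟩ := exists_intCast_eq x
      simp only [Set.mem_ofPred_eq, map_intCast_mulVec_eq_iff] at hx
      obtain ⟨t, ht⟩ := h (x - x₀) (fun i => by
        rw [Matrix.mulVec_sub]
        simpa using dvd_sub (hx i) (hx₀q i))
      refine ⟨fun j => ((x + (q : ℤ) • t) j : ℤ), fun i => ?_, ?_⟩
      · rw [map_intCast_mulVec_eq_iff, Nat.cast_mul]
        have hsum : (M *ᵥ (x + (q : ℤ) • t)) i - c i =
            (M *ᵥ (x - x₀ + (q : ℤ) • t)) i + ((M *ᵥ x₀) i - c i) := by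
          simp only [Matrix.mulVec_add, Matrix.mulVec_sub, Pi.add_apply, Pi.sub_apply]
          ring
        exact hsum ▸ dvd_add (ht i) (hx₀ i)
      · ext j
        simp

/-- Let `M` have rank `r` over `ℚ` with a Smith normal form witnessed by
unimodular `P`, `Q`, and positive diagonal entries `d 0 ∣ ⋯ ∣ d (r-1)`. Suppose
`M x ≡ c (mod pq)` has a solution. Then the entrywise reduction map
`(ℤ/pqℤ)^n → (ℤ/qℤ)^n` maps the solution set of `[M]_{pq} x = [c]_{pq}` onto the solution
set of `[M]_q x = [c]_q` if and only if `gcd(p, dᵢ) · gcd(q, dᵢ) ∣ dᵢ` for every `i < r`. -/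
theorem statement12 {m n r : ℕ} (M : Matrix (Fin m) (Fin n) ℤ)
    (hrank : (M.map (Int.cast : ℤ → ℚ)).rank = r)
    (P : Matrix (Fin m) (Fin m) ℤ) (Q : Matrix (Fin n) (Fin n) ℤ)
    (hP : IsUnit P.det) (hQ : IsUnit Q.det)
    (d : ℕ → ℤ) (hdpos : ∀ j, j < r → 0 < d j)
    (hdvd : ∀ j, j + 1 < r → d j ∣ d (j + 1))
    (hdiag : P * M * Q = Matrix.of (fun (i : Fin m) (j : Fin n) =>
      if (i : ℕ) = (j : ℕ) ∧ (i : ℕ) < r then d (i : ℕ) else 0))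
    (c : Fin m → ℤ) (p q : ℕ) (hp : 0 < p) (hq : 0 < q)
    (hsol : ∃ x : Fin n → ZMod (p * q),
      ∀ i, (M.map (Int.cast : ℤ → ZMod (p * q))).mulVec x i = (c i : ZMod (p * q))) :
    ((fun (x : Fin n → ZMod (p * q)) (j : Fin n) =>
        ZMod.castHom (dvd_mul_left q p) (ZMod q) (x j)) ''
      {x : Fin n → ZMod (p * q) |
        ∀ i, (M.map (Int.cast : ℤ → ZMod (p * q))).mulVec x i = (c i : ZMod (p * q))} =
      {x : Fin n → ZMod q |
        ∀ i, (M.map (Int.cast : ℤ → ZMod q)).mulVec x i = (c i : ZMod q)}) ↔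
    (∀ i, i < r →
      ((Int.gcd (p : ℤ) (d i) * Int.gcd (q : ℤ) (d i) : ℕ) : ℤ) ∣ d i) := by
  have hm : r ≤ m := by simpa [hrank] using (M.map (Int.cast : ℤ → ℚ)).rank_le_height
  have hn : r ≤ n := by simpa [hrank] using (M.map (Int.cast : ℤ → ℚ)).rank_le_width
  rw [image_castHom_eq_iff_kernelLifts M c p q hsol, ← kernelLifts_mul_mul_iff M p q hP hQ, hdiag,
    kernelLifts_diag_iff hm hn]
  refine forall₂_congr fun i _ => ?_
  rw [forall_exists_dvd_mul_add_iff (by exact_mod_cast hq.ne'), Nat.cast_mul]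
end

section
/- Suppose the l×n integer matrix B has rank r over ℚ and positive invariant factors d_1 ∣ ⋯ ∣ d_r, witnessed by P ∈ GL_l(ℤ) and Q ∈ GL_n(ℤ) with PBQ equal to the diagonal matrix with diagonal entries d_1,…,d_r followed by zeros. Let p, q be positive integers such that gcd(p, d_i) · gcd(q, d_i) divides d_i for every i = 1,…,r, and such that the system Bx ≡ 𝒃 (mod pq) has a solution. Then N_{A,𝒂,B,𝒃}(q) ≤ N_{A,𝒂,B,𝒃}(pq). -/
open Matrix

/-- If `gcd(p, d) * gcd(q, d) ∣ d`, every solution of `d * u ≡ 0 (mod q)` is congruent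
modulo `q` to a solution of `d * v ≡ 0 (mod p * q)`. -/
theorem exists_lift_of_gcd_mul_gcd_dvd {p q d u : ℤ} (hq : q ≠ 0)
    (hgcd : (Int.gcd p d : ℤ) * Int.gcd q d ∣ d) (hu : q ∣ d * u) :
    ∃ v : ℤ, q ∣ v - u ∧ p * q ∣ d * v := by
  obtain ⟨c, hc⟩ := hgcd
  have hh : (Int.gcd q d : ℤ) ≠ 0 := by
    simp [Int.gcd_eq_zero_iff, hq]
  obtain ⟨q', hq'⟩ : (Int.gcd q d : ℤ) ∣ q := Int.gcd_dvd_left _ _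
  have hdu : q * Int.gcd p d ∣ d * u := by
    obtain ⟨s, hs⟩ : q' ∣ u := by
      have h1 : q ∣ (Int.gcd q d : ℤ) * u := by
        rw [Int.gcd_eq_gcd_ab]
        obtain ⟨e, he⟩ := hu
        exact ⟨u * Int.gcdA q d + e * Int.gcdB q d, by linear_combination Int.gcdB q d * he⟩
      obtain ⟨e, he⟩ := h1
      exact ⟨e, mul_left_cancel₀ hh (by linear_combination he + e * hq')⟩
    refine ⟨c * s, ?_⟩
    linear_combination u * hc + Int.gcd p d * Int.gcd q d * c * hs -
      Int.gcd p d * c * s * hq'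
  obtain ⟨e, he⟩ := hdu
  have hb := Int.gcd_eq_gcd_ab p d
  exact ⟨u - q * (e * Int.gcdB p d), ⟨-(e * Int.gcdB p d), by ring⟩,
    e * Int.gcdA p d, by linear_combination he + q * e * hb⟩

/-- If all entries of `v` are divisible by `N`, so are those of `M *ᵥ v`. -/
theorem dvd_mulVec_of_forall_dvd {ι κ : Type*} [Fintype κ] (M : Matrix ι κ ℤ) {v : κ → ℤ} {N : ℤ}
    (h : ∀ j, N ∣ v j) (i : ι) : N ∣ (M *ᵥ v) i :=
  Finset.dvd_sum fun j _ => (h j).mul_left _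

/-- Lifting of solutions of a homogeneous system modulo `q` to solutions modulo `p * q`,
for a matrix in Smith normal form up to unimodular transformations. -/
theorem exists_mulVec_lift {n l r : ℕ} (B : Matrix (Fin l) (Fin n) ℤ)
    (P : Matrix (Fin l) (Fin l) ℤ) (Q : Matrix (Fin n) (Fin n) ℤ)
    (hP : IsUnit P.det) (hQ : IsUnit Q.det) (d : ℕ → ℤ)
    (hdiag : P * B * Q = Matrix.of (fun (i : Fin l) (j : Fin n) =>
      if (i : ℕ) = (j : ℕ) ∧ (i : ℕ) < r then d (i : ℕ) else 0))
    {p q : ℤ} (hq : q ≠ 0)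
    (hgcd : ∀ i, i < r → (Int.gcd p (d i) : ℤ) * Int.gcd q (d i) ∣ d i)
    (z : Fin n → ℤ) (hz : ∀ k, q ∣ (B *ᵥ z) k) :
    ∃ w : Fin n → ℤ, (∀ j, q ∣ w j - z j) ∧ ∀ k, p * q ∣ (B *ᵥ w) k := by
  have hmul (v : Fin n → ℤ) (i : Fin l) : ((P * B * Q) *ᵥ v) i =
      if h : (i : ℕ) < n ∧ (i : ℕ) < r then d i * v ⟨i, h.1⟩ else 0 := by
    rw [hdiag]
    simp only [Matrix.mulVec, dotProduct, Matrix.of_apply]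
    split_ifs with h
    · rw [Finset.sum_eq_single ⟨i, h.1⟩]
      · simp [h.2]
      · intro j _ hj
        rw [if_neg, zero_mul]
        rintro ⟨h1, -⟩
        exact hj (Fin.ext h1.symm)
      · simp
    · refine Finset.sum_eq_zero fun j _ => ?_
      rw [if_neg, zero_mul]
      rintro ⟨h1, h2⟩
      exact h ⟨h1 ▸ j.2, h2⟩
  have hu (i : Fin l) : q ∣ ((P * B * Q) *ᵥ (Q⁻¹ *ᵥ z)) i := by
    rw [Matrix.mulVec_mulVec, Matrix.mul_assoc, Matrix.mul_nonsing_inv _ hQ, Matrix.mul_one,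
      ← Matrix.mulVec_mulVec]
    exact dvd_mulVec_of_forall_dvd P hz i
  have hlift (j : Fin n) : ∃ v : ℤ, q ∣ v - (Q⁻¹ *ᵥ z) j ∧
      ((j : ℕ) < l → (j : ℕ) < r → p * q ∣ d j * v) := by
    by_cases h : (j : ℕ) < l ∧ (j : ℕ) < r
    · have h1 := hu ⟨j, h.1⟩
      rw [hmul, dif_pos ⟨j.2, h.2⟩] at h1
      obtain ⟨v, hv1, hv2⟩ := exists_lift_of_gcd_mul_gcd_dvd hq (hgcd j h.2) h1
      exact ⟨v, hv1, fun _ _ => hv2⟩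
    · exact ⟨(Q⁻¹ *ᵥ z) j, by simp, fun h1 h2 => absurd ⟨h1, h2⟩ h⟩
  choose v hv1 hv2 using hlift
  refine ⟨Q *ᵥ v, fun j => ?_, fun k => ?_⟩
  · have h := dvd_mulVec_of_forall_dvd Q (v := v - Q⁻¹ *ᵥ z) hv1 j
    rwa [Matrix.mulVec_sub, Matrix.mulVec_mulVec, Matrix.mul_nonsing_inv _ hQ,
      Matrix.one_mulVec] at h
  · have h (i : Fin l) : p * q ∣ ((P * B * Q) *ᵥ v) i := by
      rw [hmul]
      split_ifs with hi
      · exact hv2 ⟨i, hi.1⟩ i.2 hi.2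
      · exact dvd_zero _
    have h' := dvd_mulVec_of_forall_dvd P⁻¹ h k
    rwa [Matrix.mulVec_mulVec, Matrix.mul_assoc, Matrix.nonsing_inv_mul_cancel_left _ _ hP,
      ← Matrix.mulVec_mulVec] at h'

/-- Reduction modulo `N` commutes with multiplying an integer matrix by an integer vector. -/
theorem map_intCast_mulVec {ι κ : Type*} [Fintype κ] (M : Matrix ι κ ℤ) (v : κ → ℤ) (N : ℕ)
    (i : ι) : (M.map (Int.cast : ℤ → ZMod N)).mulVec (fun j => (v j : ZMod N)) i =
      ((M *ᵥ v) i : ZMod N) := by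
  simp [Matrix.mulVec, dotProduct]

/-- Every vector over `ZMod N` is the reduction of an integer vector. -/
theorem exists_intCast_vec {κ : Type*} {N : ℕ} (x : κ → ZMod N) :
    ∃ v : κ → ℤ, x = fun j => (v j : ZMod N) := by
  choose v hv using fun j => ZMod.intCast_surjective (x j)
  exact ⟨v, funext fun j => (hv j).symm⟩

/-- Suppose `B` has rank `r` over `ℚ` and positive invariant factors
`d 0 ∣ ⋯ ∣ d (r-1)` witnessed by unimodular `P`, `Q` putting `B` into Smith normal form.
If `gcd(p, dᵢ) · gcd(q, dᵢ) ∣ dᵢ` for all `i < r` and `B x ≡ b (mod pq)` is solvable, then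
`N_{A,a,B,b}(q) ≤ N_{A,a,B,b}(pq)`. -/
theorem statement13 {m n l r : ℕ} (A : Matrix (Fin m) (Fin n) ℤ) (a : Fin m → ℤ)
    (B : Matrix (Fin l) (Fin n) ℤ) (b : Fin l → ℤ)
    (hrank : (B.map (Int.cast : ℤ → ℚ)).rank = r)
    (P : Matrix (Fin l) (Fin l) ℤ) (Q : Matrix (Fin n) (Fin n) ℤ)
    (hP : IsUnit P.det) (hQ : IsUnit Q.det)
    (d : ℕ → ℤ) (hdpos : ∀ j, j < r → 0 < d j)
    (hdvd : ∀ j, j + 1 < r → d j ∣ d (j + 1))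
    (hdiag : P * B * Q = Matrix.of (fun (i : Fin l) (j : Fin n) =>
      if (i : ℕ) = (j : ℕ) ∧ (i : ℕ) < r then d (i : ℕ) else 0))
    (p q : ℕ) (hp : 0 < p) (hq : 0 < q)
    (hgcd : ∀ i, i < r →
      ((Int.gcd (p : ℤ) (d i) * Int.gcd (q : ℤ) (d i) : ℕ) : ℤ) ∣ d i)
    (hsol : ∃ x : Fin n → ZMod (p * q),
      ∀ k, (B.map (Int.cast : ℤ → ZMod (p * q))).mulVec x k = (b k : ZMod (p * q))) :
    Ncount A a B b q ≤ Ncount A a B b (p * q) := by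
  have : NeZero (p * q) := ⟨(Nat.mul_pos hp hq).ne'⟩
  obtain ⟨y, hy⟩ := hsol
  obtain ⟨Y, rfl⟩ := exists_intCast_vec y
  have hY (k) : (p * q : ℤ) ∣ (B *ᵥ Y) k - b k := by
    have h := hy k
    rw [map_intCast_mulVec, eq_comm, ZMod.intCast_eq_intCast_iff_dvd_sub] at h
    exact_mod_cast h
  have hlift (x : {x : Fin n → ZMod q //
      (∀ k, (B.map (Int.cast : ℤ → ZMod q)).mulVec x k = (b k : ZMod q)) ∧
      ∀ i, (A.map (Int.cast : ℤ → ZMod q)).mulVec x i ≠ (a i : ZMod q)}) :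
      ∃ w : Fin n → ℤ, x.1 = (fun j => (w j : ZMod q)) ∧
        ∀ k, ((p * q : ℕ) : ℤ) ∣ (B *ᵥ w) k - b k := by
    obtain ⟨x, hx, -⟩ := x
    obtain ⟨X, rfl⟩ := exists_intCast_vec x
    have hX (k) : (q : ℤ) ∣ (B *ᵥ X) k - b k := by
      have h := hx k
      rwa [map_intCast_mulVec, eq_comm, ZMod.intCast_eq_intCast_iff_dvd_sub] at h
    obtain ⟨w, hw1, hw2⟩ := exists_mulVec_lift B P Q hP hQ d hdiag (p := p) (q := q)
      (by exact_mod_cast hq.ne') (fun i hi => by exact_mod_cast hgcd i hi) (X - Y) (fun k => by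
        have h := dvd_sub (hX k) ((Dvd.intro_left _ rfl).trans (hY k))
        rwa [sub_sub_sub_cancel_right, ← Pi.sub_apply, ← Matrix.mulVec_sub] at h)
    refine ⟨w + Y, funext fun j => ?_, fun k => ?_⟩
    · rw [ZMod.intCast_eq_intCast_iff_dvd_sub]
      convert hw1 j using 1
      simp only [Pi.add_apply, Pi.sub_apply]
      ring
    · rw [Matrix.mulVec_add, Pi.add_apply, add_sub_assoc]
      push_cast
      exact dvd_add (hw2 k) (hY k)
  choose w hw1 hw2 using hlift
  refine Nat.card_le_card_of_injective
    (fun x => ⟨fun j => (w x j : ZMod (p * q)), fun k => ?_, fun i hi => ?_⟩) ?_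
  · rw [map_intCast_mulVec, eq_comm, ZMod.intCast_eq_intCast_iff_dvd_sub]
    exact hw2 x k
  · refine x.2.2 i ?_
    rw [map_intCast_mulVec, ZMod.intCast_eq_intCast_iff_dvd_sub] at hi
    rw [hw1 x, map_intCast_mulVec, ZMod.intCast_eq_intCast_iff_dvd_sub]
    exact (Int.natCast_dvd_natCast.2 (Dvd.intro_left p rfl)).trans hi
  · intro x x' h
    refine Subtype.ext ?_
    rw [hw1 x, hw1 x']
    funext j
    have hj := congrFun (Subtype.ext_iff.1 h) j
    simp only [ZMod.intCast_eq_intCast_iff_dvd_sub] at hj ⊢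
    exact (Int.natCast_dvd_natCast.2 (Dvd.intro_left p rfl)).trans hj
end

section
/- For all positive integers p and q, #{x ∈ (ℤ/qℤ)^n : [α_i]_qᵀ x ≠ [a_i]_q for all i = 1,…,m} ≤ #{x ∈ (ℤ/pqℤ)^n : [α_i]_{pq}ᵀ x ≠ [a_i]_{pq} for all i = 1,…,m}. -/
open Matrix

/-- For all positive integers `p` and `q`, the number of points of
`(ℤ/qℤ)^n` avoiding all the hyperplanes `[αᵢ]_qᵀ x = [aᵢ]_q` is at most the corresponding
number in `(ℤ/pqℤ)^n`. -/
theorem statement14 {m n : ℕ} (A : Matrix (Fin m) (Fin n) ℤ) (a : Fin m → ℤ)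
    (p q : ℕ) (hp : 0 < p) (hq : 0 < q) :
    Nat.card {x : Fin n → ZMod q //
        ∀ i, (A.map (Int.cast : ℤ → ZMod q)).mulVec x i ≠ (a i : ZMod q)} ≤
      Nat.card {x : Fin n → ZMod (p * q) //
        ∀ i, (A.map (Int.cast : ℤ → ZMod (p * q))).mulVec x i ≠ (a i : ZMod (p * q))} := by
  have : NeZero (p * q) := ⟨(Nat.mul_pos hp hq).ne'⟩
  let f : ZMod (p * q) →+* ZMod q := ZMod.castHom (dvd_mul_left q p) (ZMod q)
  have hf : Function.Surjective f := ZMod.castHom_surjective _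
  obtain ⟨g, hg⟩ := hf.hasRightInverse
  refine Nat.card_le_card_of_injective
    (fun x => ⟨fun j => g (x.1 j), fun i h => x.2 i ?_⟩) fun x y hxy => ?_
  · have h' := congrArg f h
    simpa [Matrix.mulVec, dotProduct, hg _] using h'
  · ext j : 2
    exact hg.injective (congrFun (congrArg Subtype.val hxy) j)
end

section
/- There exist a nonnegative integer q₀ and a polynomial f ∈ ℤ[t] such that for every integer q > q₀, the number of (ℤ/qℤ, w)-colorings of G, namely #{c : V → ℤ/qℤ : c(h(e)) − c(t(e)) ≠ [w(e)]_q for every edge e ∈ E}, equals f(q). -/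
/-- The `ZMod q`-colorings of `V` such that `c a - c b ≠ k` for every triple `(a, b, k)` of `L`. -/
def weightedColorings {V : Type*} (L : List (V × V × ℤ)) (q : ℕ) : Set (V → ZMod q) :=
  {c | ∀ x ∈ L, c x.1 - c x.2.1 ≠ (x.2.2 : ZMod q)}

/-- Deletion-contraction: the colorings that are proper on `L` and violate the constraint
`(a, b, k)` are the colorings of the graph in which `a` has been merged into `b`. -/
theorem ncard_weightedColorings_inter_eq {V : Type*} [DecidableEq V] (L : List (V × V × ℤ))
    {a b : V} (hab : b ≠ a) (k : ℤ) (q : ℕ) :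
    (weightedColorings L q ∩ {c | c a - c b = (k : ZMod q)}).ncard =
      (weightedColorings (L.map fun x : V × V × ℤ =>
        ((if hx : x.1 = a then ⟨b, hab⟩ else ⟨x.1, hx⟩ : {v // v ≠ a}),
          (if hx : x.2.1 = a then ⟨b, hab⟩ else ⟨x.2.1, hx⟩ : {v // v ≠ a}),
          x.2.2 - (if x.1 = a then k else 0) + (if x.2.1 = a then k else 0))) q).ncard := by
  refine Set.ncard_congr (fun c _ v => c v) ?_ ?_ ?_
  · rintro c ⟨hL, hk⟩
    simp only [weightedColorings, List.mem_map, Set.mem_ofPred_eq] at *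
    rintro _ ⟨⟨x, y, m⟩, hx, rfl⟩ h
    apply hL _ hx
    dsimp only at h ⊢
    split_ifs at h <;> subst_vars <;> push_cast at h <;> grind
  · rintro c d ⟨-, hc⟩ ⟨-, hd⟩ h
    simp only [Set.mem_ofPred_eq] at hc hd
    have hv (v : V) (hv : v ≠ a) : c v = d v := congrFun h ⟨v, hv⟩
    funext v
    by_cases hva : v = a
    · subst hva
      linear_combination hc - hd + hv b hab
    · exact hv v hva
  · intro d hd
    refine ⟨fun v => if hv : v = a then d ⟨b, hab⟩ + k else d ⟨v, hv⟩, ⟨?_, ?_⟩, ?_⟩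
    · simp only [weightedColorings, List.mem_map, Set.mem_ofPred_eq] at *
      rintro ⟨x, y, m⟩ hx h
      apply hd _ ⟨_, hx, rfl⟩
      dsimp only at h ⊢
      split_ifs at h ⊢ <;> push_cast <;> grind
    · simp [hab]
    · funext v
      simp [v.2]

theorem exists_polynomial_ncard_weightedColorings (n : ℕ) :
    ∀ {V : Type*} [Finite V] (L : List (V × V × ℤ)), L.length = n →
      ∃ (q₀ : ℕ) (f : Polynomial ℤ), ∀ q : ℕ, q₀ < q →
        ((weightedColorings L q).ncard : ℤ) = f.eval (q : ℤ) := by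
  classical
  induction n with
  | zero =>
    intro V _ L hL
    obtain rfl := List.length_eq_zero_iff.mp hL
    refine ⟨0, Polynomial.X ^ Nat.card V, fun q hq => ?_⟩
    simp [weightedColorings, Set.ncard_univ, Nat.card_fun]
  | succ n ih =>
    intro V _ L hL
    obtain _ | ⟨⟨a, b, k⟩, L⟩ := L
    · simp at hL
    replace hL : L.length = n := by simpa using hL
    obtain ⟨q₁, f₁, h₁⟩ := ih L hL
    have hcons (q : ℕ) : weightedColorings ((a, b, k) :: L) q =
        weightedColorings L q \ {c | c a - c b = (k : ZMod q)} := by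
      ext c
      simp [weightedColorings, and_comm]
    by_cases hab : b = a
    · subst hab
      by_cases hk : k = 0
      · exact ⟨0, 0, fun q _ => by subst hk; simp [hcons]⟩
      · refine ⟨max q₁ k.natAbs, f₁, fun q hq => ?_⟩
        have hkq : (0 : ZMod q) ≠ k := by
          rw [ne_comm, Ne, ZMod.intCast_zmod_eq_zero_iff_dvd]
          exact fun hd => by have := Int.natAbs_le_of_dvd_ne_zero hd hk; lia
        rw [hcons, ← h₁ q (lt_of_le_of_lt (le_max_left _ _) hq)]
        simp [hkq]
    · obtain ⟨q₂, f₂, h₂⟩ := ih (V := {v // v ≠ a}) _ ((List.length_map _).trans hL)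
      refine ⟨max q₁ q₂, f₁ - f₂, fun q hq => ?_⟩
      have : NeZero q := ⟨by lia⟩
      rw [Polynomial.eval_sub, ← h₁ q (by lia), ← h₂ q (by lia),
        ← ncard_weightedColorings_inter_eq L hab k q, hcons,
        ← Set.ncard_inter_add_ncard_sdiff_eq_ncard (weightedColorings L q)
          {c | c a - c b = (k : ZMod q)}]
      push_cast
      ring

/-- For a finite oriented graph with head map `h`, tail map `t`, and
integer edge weights `w`, there are `q₀ ≥ 0` and a polynomial `f ∈ ℤ[t]` such that for
every `q > q₀`, the number of `(ℤ/qℤ, w)`-colorings, i.e. of maps `c : V → ℤ/qℤ` with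
`c (h e) − c (t e) ≠ [w e]_q` for every edge `e`, equals `f(q)`. -/
theorem statement15 {V E : Type*} [Fintype V] [Fintype E]
    (h t : E → V) (w : E → ℤ) :
    ∃ (q₀ : ℕ) (f : Polynomial ℤ), ∀ q : ℕ, q₀ < q →
      (Nat.card {c : V → ZMod q //
          ∀ e : E, c (h e) - c (t e) ≠ (w e : ZMod q)} : ℤ) = f.eval (q : ℤ) := by
  obtain ⟨q₀, f, hf⟩ := exists_polynomial_ncard_weightedColorings _
    (Finset.univ.toList.map fun e : E => (h e, t e, w e)) rfl
  refine ⟨q₀, f, fun q hq => ?_⟩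
  rw [← hf q hq]
  simp only [weightedColorings, List.mem_map, Finset.mem_toList, Finset.mem_univ, true_and,
    forall_exists_index, forall_apply_eq_imp_iff, ← Nat.card_coe_set_eq]
  rfl
end

section
/- For all positive integers p and q, #{c : V → ℤ/qℤ : c(h(e)) − c(t(e)) ≠ [w(e)]_q for every e ∈ E} ≤ #{c : V → ℤ/pqℤ : c(h(e)) − c(t(e)) ≠ [w(e)]_{pq} for every e ∈ E}. -/
/-- For a finite oriented graph with integer edge weights `w` and all
positive integers `p`, `q`, the number of `(ℤ/qℤ, w)`-colorings is at most the number of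
`(ℤ/pqℤ, w)`-colorings. -/
theorem statement16 {V E : Type*} [Fintype V] [Fintype E]
    (h t : E → V) (w : E → ℤ) (p q : ℕ) (hp : 0 < p) (hq : 0 < q) :
    Nat.card {c : V → ZMod q //
        ∀ e : E, c (h e) - c (t e) ≠ (w e : ZMod q)} ≤
      Nat.card {c : V → ZMod (p * q) //
        ∀ e : E, c (h e) - c (t e) ≠ (w e : ZMod (p * q))} := by
  have : NeZero (p * q) := ⟨(Nat.mul_pos hp hq).ne'⟩
  let π : ZMod (p * q) →+* ZMod q := ZMod.castHom (Dvd.intro_left p rfl) (ZMod q)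
  obtain ⟨s, hs⟩ := (ZMod.ringHom_surjective π).hasRightInverse
  refine Nat.card_le_card_of_injective
    (fun c ↦ ⟨fun v ↦ s (c.1 v), fun e he ↦ c.2 e ?_⟩) fun c d hcd ↦ ?_
  · simpa only [map_sub, hs _, map_intCast] using congrArg π he
  · ext1
    funext v
    exact hs.injective (congrFun (congrArg Subtype.val hcd) v)
end

section
/- There exist a nonnegative integer q₀ and a polynomial τ ∈ ℤ[t] such that for every integer q > q₀, the number of nowhere-zero (ℤ/qℤ, b)-flows of G, namely #{f : E → ℤ/qℤ : f(e) ≠ 0 for all e ∈ E, and for every v ∈ V, Σ_{e : h(e)=v} f(e) − Σ_{e : t(e)=v} f(e) = [b(v)]_q}, equals τ(q). -/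
/-- The net inflow at the vertex `v` of an edge labelling `f`. -/
def netInflow {V E A : Type*} [Fintype E] [DecidableEq V] [AddCommGroup A]
    (h t : E → V) (f : E → A) (v : V) : A :=
  ∑ e, ((if h e = v then f e else 0) - (if t e = v then f e else 0))

/-- The number of nowhere-zero `A`-valued flows with prescribed net inflow `b`. -/
noncomputable def flowCount {V E A : Type*} [Fintype E] [DecidableEq V] [AddCommGroup A]
    (h t : E → V) (b : V → A) : ℕ :=
  Nat.card {f : E → A // (∀ e, f e ≠ 0) ∧ ∀ v, netInflow h t f v = b v}

section Flows

variable {V A : Type*} [DecidableEq V] [AddCommGroup A]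

theorem netInflow_cons {n : ℕ} (h t : Fin (n + 1) → V) (x : A) (g : Fin n → A) (v : V) :
    netInflow h t (Fin.cons x g : Fin (n + 1) → A) v =
      ((if h 0 = v then x else 0) - (if t 0 = v then x else 0)) +
        netInflow (Fin.tail h) (Fin.tail t) g v := by
  simp only [netInflow, Fin.sum_univ_succ, Fin.cons_zero, Fin.cons_succ]
  rfl

/-- Move the value of `b` at `u` to `w`. -/
def mergeValues {M : Type*} [AddZeroClass M] (u w : V) (b : V → M) (v : V) : M :=
  if v = u then 0 else if v = w then b u + b w else b v

theorem netInflow_update {E : Type*} [Fintype E] (h t : E → V) (f : E → A) {u w : V}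
    (huw : u ≠ w) :
    netInflow (fun e => Function.update id u w (h e)) (fun e => Function.update id u w (t e)) f =
      mergeValues u w (netInflow h t f) := by
  have key : ∀ (x : V) (a : A) (v : V), (if Function.update id u w x = v then a else 0) =
      mergeValues u w (fun v => if x = v then a else 0) v := by
    intro x a v
    simp only [mergeValues, Function.update_apply, id]
    by_cases h1 : x = u <;> by_cases h2 : v = u <;> by_cases h3 : v = w <;>
      by_cases h4 : x = w <;> grind
  funext v
  simp only [netInflow, key, mergeValues]
  split_ifs
  · simp
  · rw [← Finset.sum_add_distrib]
    exact Finset.sum_congr rfl fun e _ => by abel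
  · rfl

theorem forall_netInflow_cons_iff {n : ℕ} (h t : Fin (n + 1) → V) (b : V → A)
    (h0 : h 0 ≠ t 0) (x : A) (g : Fin n → A) :
    (∀ v, netInflow h t (Fin.cons x g : Fin (n + 1) → A) v = b v) ↔
      x = b (h 0) - netInflow (Fin.tail h) (Fin.tail t) g (h 0) ∧
      ∀ v, netInflow (fun e => Function.update id (h 0) (t 0) (Fin.tail h e))
        (fun e => Function.update id (h 0) (t 0) (Fin.tail t e)) g v =
          mergeValues (h 0) (t 0) b v := by
  simp only [netInflow_cons, netInflow_update _ _ _ h0]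
  generalize netInflow (Fin.tail h) (Fin.tail t) g = N
  generalize h 0 = u at *
  generalize t 0 = w at *
  constructor
  · intro H
    have hu := H u
    have hw := H w
    simp only [if_true, if_neg h0, if_neg h0.symm, sub_zero, zero_sub] at hu hw
    refine ⟨by rw [← hu]; abel, fun v => ?_⟩
    unfold mergeValues
    split_ifs with h1 h2
    · rfl
    · rw [← hu, ← hw]; abel
    · simpa [Ne.symm h1, Ne.symm h2] using H v
  · rintro ⟨rfl, H⟩ v
    by_cases h1 : v = u
    · subst h1; simp [h0.symm]
    by_cases h2 : v = w
    · subst h2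
      have := H v
      simp only [mergeValues, if_neg h1, if_true] at this
      simp only [if_neg h0, if_true, zero_sub]
      rw [eq_sub_of_add_eq' this]
      abel
    · have := H v
      simp only [mergeValues, if_neg h1, if_neg h2] at this
      simpa [Ne.symm h1, Ne.symm h2] using this

/-- Contraction of a non-loop edge: the nowhere-zero flows of the contracted graph are those flows
of the original graph that vanish at most on the contracted edge. -/
theorem flowCount_contract [Finite A] {n : ℕ} (h t : Fin (n + 1) → V) (b : V → A)
    (h0 : h 0 ≠ t 0) :
    flowCount (fun e => Function.update id (h 0) (t 0) (Fin.tail h e))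
        (fun e => Function.update id (h 0) (t 0) (Fin.tail t e)) (mergeValues (h 0) (t 0) b) =
      flowCount h t b + flowCount (Fin.tail h) (Fin.tail t) b := by
  classical
  let x : (Fin n → A) → A := fun g => b (h 0) - netInflow (Fin.tail h) (Fin.tail t) g (h 0)
  let P : (Fin n → A) → Prop := fun g => (∀ e, g e ≠ 0) ∧
    ∀ v, netInflow (fun e => Function.update id (h 0) (t 0) (Fin.tail h e))
      (fun e => Function.update id (h 0) (t 0) (Fin.tail t e)) g v = mergeValues (h 0) (t 0) b v
  have hsplit : Nat.card {g // P g} =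
      Nat.card {g // P g ∧ x g ≠ 0} + Nat.card {g // P g ∧ x g = 0} := by
    rw [← Nat.card_sum]
    refine Nat.card_congr ((Equiv.sumCompl fun g : {g // P g} => x g ≠ 0).symm.trans
      (Equiv.sumCongr (Equiv.subtypeSubtypeEquivSubtypeInter P fun g => x g ≠ 0)
        ((Equiv.subtypeSubtypeEquivSubtypeInter P fun g => ¬ x g ≠ 0).trans
          (Equiv.subtypeEquivRight fun g => by simp))))
  have hne : flowCount h t b = Nat.card {g // P g ∧ x g ≠ 0} := by
    refine Nat.card_congr
      { toFun := fun f => ⟨Fin.tail f.1, ?_⟩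
        invFun := fun g => ⟨Fin.cons (x g.1) g.1, ?_⟩
        left_inv := ?_
        right_inv := ?_ }
    · obtain ⟨f, hf, hflow⟩ := f
      rw [← Fin.cons_self_tail f, forall_netInflow_cons_iff h t b h0] at hflow
      exact ⟨⟨fun e => hf _, hflow.2⟩, fun hx => hf 0 (hflow.1.trans hx)⟩
    · obtain ⟨g, ⟨hg, hflow⟩, hx⟩ := g
      exact ⟨Fin.cases hx hg, (forall_netInflow_cons_iff h t b h0 _ _).2 ⟨rfl, hflow⟩⟩
    · rintro ⟨f, hf, hflow⟩
      rw [← Fin.cons_self_tail f, forall_netInflow_cons_iff h t b h0] at hflow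
      refine Subtype.ext ?_
      change Fin.cons (x (Fin.tail f)) (Fin.tail f) = f
      conv_rhs => rw [← Fin.cons_self_tail f, hflow.1]
    · rintro ⟨g, hg⟩
      rfl
  have heq : flowCount (Fin.tail h) (Fin.tail t) b = Nat.card {g // P g ∧ x g = 0} := by
    refine Nat.card_congr (Equiv.subtypeEquivRight fun g => ?_)
    have := forall_netInflow_cons_iff h t b h0 0 g
    simp only [netInflow_cons, ite_self, sub_self, zero_add] at this
    rw [this, eq_comm (a := (0 : A))]
    tauto
  rw [hne, heq, ← hsplit]
  rfl

/-- A loop may carry any nonzero value. -/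
theorem flowCount_loop [Finite A] {n : ℕ} (h t : Fin (n + 1) → V) (b : V → A)
    (h0 : h 0 = t 0) :
    (flowCount h t b : ℤ) = (Nat.card A - 1) * flowCount (Fin.tail h) (Fin.tail t) b := by
  classical
  have hA : (Nat.card {x : A // x ≠ 0} : ℤ) = Nat.card A - 1 := by
    have := Fintype.ofFinite A
    rw [Nat.card_eq_fintype_card, Nat.card_eq_fintype_card, Fintype.card_subtype_compl,
      Fintype.card_subtype_eq, Nat.cast_sub Fintype.card_pos]
    simp
  have hloop : ∀ (x : A) (g : Fin n → A) (v : V),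
      netInflow h t (Fin.cons x g : Fin (n + 1) → A) v =
        netInflow (Fin.tail h) (Fin.tail t) g v := fun x g v => by
    rw [netInflow_cons, h0, sub_self, zero_add]
  rw [← hA, flowCount, flowCount, ← Nat.cast_mul, ← Nat.card_prod]
  refine congrArg _ (Nat.card_congr
    { toFun := fun f => (⟨f.1 0, f.2.1 0⟩, ⟨Fin.tail f.1, fun e => f.2.1 _, ?_⟩)
      invFun := fun p => ⟨Fin.cons p.1.1 p.2.1, Fin.cases p.1.2 p.2.2.1, ?_⟩
      left_inv := ?_
      right_inv := ?_ })
  · intro v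
    rw [← hloop (f.1 0), Fin.cons_self_tail]
    exact f.2.2 v
  · intro v
    rw [hloop]
    exact p.2.2.2 v
  · rintro ⟨f, hf⟩
    exact Subtype.ext (Fin.cons_self_tail f)
  · rintro ⟨⟨x, hx⟩, ⟨g, hg⟩⟩
    rfl

theorem flowCount_comp_equiv {E F : Type*} [Fintype E] [Fintype F] (σ : F ≃ E)
    (h t : E → V) (b : V → A) : flowCount (h ∘ σ) (t ∘ σ) b = flowCount h t b := by
  refine Nat.card_congr (Equiv.subtypeEquiv (σ.arrowCongr (Equiv.refl A)) fun f => ?_)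
  refine and_congr ?_ (forall_congr' fun v => ?_)
  · simp [σ.symm.forall_congr_left]
  · have : netInflow (h ∘ σ) (t ∘ σ) f v =
        netInflow h t (σ.arrowCongr (Equiv.refl A) f) v := by
      unfold netInflow
      exact Fintype.sum_equiv σ _ _ fun e => by simp
    rw [this]

end Flows

theorem exists_polynomial_flowCount_fin {V : Type*} [Fintype V] [DecidableEq V] (n : ℕ)
    (h t : Fin n → V) (b : V → ℤ) :
    ∃ (q₀ : ℕ) (τ : Polynomial ℤ), ∀ q : ℕ, q₀ < q →
      (flowCount h t (fun v => (b v : ZMod q)) : ℤ) = τ.eval (q : ℤ) := by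
  induction n generalizing b with
  | zero =>
    by_cases hb : ∀ v, b v = 0
    · refine ⟨0, 1, fun q _ => ?_⟩
      simp [flowCount, netInflow, hb]
    · push Not at hb
      obtain ⟨v, hv⟩ := hb
      refine ⟨(b v).natAbs, 0, fun q hq => ?_⟩
      have hbv : (b v : ZMod q) ≠ 0 := fun h0 => by
        rw [ZMod.intCast_zmod_eq_zero_iff_dvd] at h0
        exact hv (Int.eq_zero_of_dvd_of_natAbs_lt_natAbs h0 (by simpa using hq))
      have : IsEmpty {f : Fin 0 → ZMod q // (∀ e, f e ≠ 0) ∧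
          ∀ v, netInflow h t f v = (b v : ZMod q)} :=
        ⟨fun f => hbv (by simpa [netInflow] using (f.2.2 v).symm)⟩
      rw [flowCount, Nat.card_of_isEmpty]
      simp
  | succ n ih =>
    obtain ⟨q₁, τ₁, h₁⟩ := ih (Fin.tail h) (Fin.tail t) b
    by_cases h0 : h 0 = t 0
    · refine ⟨q₁, (Polynomial.X - 1) * τ₁, fun q hq => ?_⟩
      have : NeZero q := ⟨by omega⟩
      rw [flowCount_loop h t _ h0, h₁ q hq]
      simp
    · obtain ⟨q₂, τ₂, h₂⟩ := ih (fun e => Function.update id (h 0) (t 0) (Fin.tail h e))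
        (fun e => Function.update id (h 0) (t 0) (Fin.tail t e)) (mergeValues (h 0) (t 0) b)
      refine ⟨max q₁ q₂, τ₂ - τ₁, fun q hq => ?_⟩
      have : NeZero q := ⟨by omega⟩
      have hcast : (fun v => ((mergeValues (h 0) (t 0) b v : ℤ) : ZMod q)) =
          mergeValues (h 0) (t 0) fun v => (b v : ZMod q) := by
        funext v
        unfold mergeValues
        split_ifs <;> simp
      have e₂ := h₂ q (lt_of_le_of_lt (le_max_right _ _) hq)
      rw [hcast, flowCount_contract h t _ h0, Nat.cast_add,
        h₁ q (lt_of_le_of_lt (le_max_left _ _) hq)] at e₂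
      rw [Polynomial.eval_sub, ← e₂, add_sub_cancel_right]

/-- For a finite oriented graph with head map `h`, tail map `t`, and
integer vertex function `b`, there are `q₀ ≥ 0` and a polynomial `τ ∈ ℤ[t]` such that for
every `q > q₀`, the number of nowhere-zero `(ℤ/qℤ, b)`-flows, i.e. of maps
`f : E → ℤ/qℤ` with `f e ≠ 0` for all `e` and, for every vertex `v`,
`Σ_{h e = v} f e − Σ_{t e = v} f e = [b v]_q`, equals `τ(q)`. -/
theorem statement17 {V E : Type*} [Fintype V] [Fintype E] [DecidableEq V]
    (h t : E → V) (b : V → ℤ) :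
    ∃ (q₀ : ℕ) (τ : Polynomial ℤ), ∀ q : ℕ, q₀ < q →
      (Nat.card {f : E → ZMod q //
          (∀ e : E, f e ≠ 0) ∧
          ∀ v : V,
            (∑ e ∈ Finset.univ.filter (fun e : E => h e = v), f e) -
              (∑ e ∈ Finset.univ.filter (fun e : E => t e = v), f e) =
            (b v : ZMod q)} : ℤ) = τ.eval (q : ℤ) := by
  obtain ⟨q₀, τ, H⟩ := exists_polynomial_flowCount_fin (Fintype.card E)
    (h ∘ (Fintype.equivFin E).symm) (t ∘ (Fintype.equivFin E).symm) b
  refine ⟨q₀, τ, fun q hq => ?_⟩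
  rw [← H q hq, flowCount_comp_equiv]
  simp only [flowCount, netInflow, Finset.sum_sub_distrib, Finset.sum_filter]
end
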